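/- arXiv:2210.09437 — 2 statements merged into one kernel-verified Lean document; each statement's English description precedes it below -/
import Mathlib

section
/- Let d ≥ 2, χ ∈ C^∞(S^{d-1}) with ∫_{S^{d-1}} χ = 1, and w ∈ S^{d-1}. Define L_{χ,w}^{jk} = ∂_l ( χ(x/|x|) (x^j x^l w^k + x^l x^k w^j − w^l x^k x^j) / |x|^d ). Then L_{χ,w} is a symmetric-2-tensor-valued distribution satisfying ∂_j L_{χ,w}^{jk} = δ_0 w^k, it is homogeneous of degree 1−d, smooth on ℝ^d \ {0}, and supported in the closed cone over supp χ. -/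
open MeasureTheory

open Set Metric Filter Topology

section Polar

variable {E : Type*} [NormedAddCommGroup E] [NormedSpace ℝ E] [MeasurableSpace E]
  [FiniteDimensional ℝ E] [BorelSpace E] [Nontrivial E]

/-- Integration in polar coordinates for an integrable function. -/
theorem integral_eq_integral_toSphere_integral_Ioi (μ : Measure E) [μ.IsAddHaarMeasure]
    {g : E → ℝ} (hg : Integrable g μ) :
    ∫ x, g x ∂μ = ∫ ω : sphere (0 : E) 1,
      (∫ r in Ioi (0 : ℝ), r ^ (Module.finrank ℝ E - 1) * g (r • (ω : E))) ∂μ.toSphere := by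
  have hmp := μ.measurePreserving_homeomorphUnitSphereProd
  have hemb := (homeomorphUnitSphereProd E).measurableEmbedding
  have hcomp : ∀ x : ({0}ᶜ : Set E),
      g (((homeomorphUnitSphereProd E x).2 : ℝ) • ((homeomorphUnitSphereProd E x).1 : E)) = g x := by
    intro x
    rw [← homeomorphUnitSphereProd_symm_apply_coe, Homeomorph.symm_apply_apply]
  have hprod : Integrable (fun p : sphere (0 : E) 1 × Ioi (0 : ℝ) => g ((p.2 : ℝ) • (p.1 : E)))
      (μ.toSphere.prod (.volumeIoiPow (Module.finrank ℝ E - 1))) := by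
    rw [← hmp.integrable_comp_emb hemb]
    simp only [Function.comp_def, hcomp]
    rw [← restrict_compl_singleton (μ := μ) 0, ← IntegrableOn,
      integrableOn_iff_comap_subtypeVal (measurableSet_singleton _).compl] at hg
    exact hg
  calc
    ∫ x, g x ∂μ = ∫ x : ({0}ᶜ : Set E), g x ∂(μ.comap (↑)) := by
      rw [integral_subtype_comap (measurableSet_singleton _).compl g, restrict_compl_singleton]
    _ = ∫ p : sphere (0 : E) 1 × Ioi (0 : ℝ), g ((p.2 : ℝ) • (p.1 : E))
          ∂μ.toSphere.prod (.volumeIoiPow (Module.finrank ℝ E - 1)) := by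
      rw [← hmp.integral_comp hemb]
      simp only [hcomp]
    _ = _ := by
      rw [integral_prod _ hprod]
      congr 1 with ω
      simp only [Measure.volumeIoiPow, ENNReal.ofReal]
      rw [integral_withDensity_eq_integral_smul,
        integral_subtype_comap measurableSet_Ioi
          fun a ↦ Real.toNNReal (a ^ (Module.finrank ℝ E - 1)) • g (a • (ω : E)),
        setIntegral_congr_fun measurableSet_Ioi fun x hx ↦ ?_]
      · simp only [NNReal.smul_def, Real.coe_toNNReal _ (pow_nonneg (mem_Ioi.1 hx).le _),
          smul_eq_mul]
      · exact (measurable_subtype_coe.pow_const _).real_toNNReal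

/-- The weight `‖x‖ ^ (2 - n)` is locally integrable in dimension `n`. -/
theorem locallyIntegrable_norm_sq_div_norm_pow_finrank (μ : Measure E) [μ.IsAddHaarMeasure] :
    LocallyIntegrable (fun x : E => ‖x‖ ^ 2 / ‖x‖ ^ Module.finrank ℝ E) μ := by
  intro x
  refine ⟨ball 0 (‖x‖ + 1), isOpen_ball.mem_nhds (by simp), ?_⟩
  refine (integrableOn_fun_norm_addHaar μ
    (f := fun r => r ^ 2 / r ^ Module.finrank ℝ E)).2 ?_
  have hid : IntegrableOn (fun r : ℝ => r) (Ioo 0 (‖x‖ + 1)) :=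
    (continuous_id.integrableOn_Icc).mono_set Ioo_subset_Icc_self
  refine hid.congr_fun (fun r hr => ?_) measurableSet_Ioo
  have hr0 : r ≠ 0 := hr.1.ne'
  obtain ⟨n, hn⟩ := Nat.exists_eq_succ_of_ne_zero (Module.finrank_pos (R := ℝ) (M := E)).ne'
  simp only [hn, Nat.succ_eq_add_one, Nat.add_sub_cancel, smul_eq_mul]
  field_simp
  ring

end Polar

/-- Taylor's formula with integral remainder, from the origin to infinity. -/
theorem integral_Ioi_mul_second_deriv_eq {φ φ' φ'' : ℝ → ℝ} (hφ : ∀ r, HasDerivAt φ (φ' r) r)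
    (hφ' : ∀ r, HasDerivAt φ' (φ'' r) r) (hcont : Continuous φ'') (hsupp : HasCompactSupport φ)
    (hsupp' : HasCompactSupport φ') (hsupp'' : HasCompactSupport φ'') :
    ∫ r in Ioi (0 : ℝ), r * φ'' r = φ 0 := by
  have key : ∀ r ∈ Ici (0 : ℝ), HasDerivAt (fun r => r * φ' r - φ r) (r * φ'' r) r := by
    intro r _
    exact (((hasDerivAt_id' r).mul (hφ' r)).sub (hφ r)).congr_deriv (by ring)
  have hlim : Tendsto (fun r => r * φ' r - φ r) atTop (𝓝 0) := by
    have hs : HasCompactSupport (fun r => r * φ' r - φ r) :=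
      (hsupp'.mul_left (f := fun r => r)).sub hsupp
    exact hs.is_zero_at_infty.mono_left atTop_le_cocompact
  have hi : IntegrableOn (fun r => r * φ'' r) (Ioi 0) :=
    ((continuous_id.mul hcont).integrable_of_hasCompactSupport
      (hsupp''.mul_left (f := fun r : ℝ => r))).integrableOn
  rw [integral_Ioi_of_hasDerivAt_of_tendsto' key hi hlim]
  simp

section Ray

variable {E : Type*} [NormedAddCommGroup E] [NormedSpace ℝ E]

theorem HasCompactSupport.comp_smul_right {g : E → ℝ} (hg : HasCompactSupport g) {v : E}
    (hv : v ≠ 0) : HasCompactSupport (fun r : ℝ => g (r • v)) :=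
  hg.comp_isClosedEmbedding (isClosedEmbedding_smul_left hv)

theorem integral_Ioi_mul_second_fderiv_ray {f : E → ℝ} (hf : ContDiff ℝ (⊤ : ℕ∞) f)
    (hfs : HasCompactSupport f) {v : E} (hv : v ≠ 0) :
    ∫ r in Ioi (0 : ℝ), r * fderiv ℝ (fderiv ℝ f) (r • v) v v = f 0 := by
  have hf' : ContDiff ℝ (⊤ : ℕ∞) (fderiv ℝ f) := hf.fderiv_right (by simp)
  have hf'' : ContDiff ℝ (⊤ : ℕ∞) (fderiv ℝ (fderiv ℝ f)) := hf'.fderiv_right (by simp)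
  have hline : ∀ r : ℝ, HasDerivAt (fun r : ℝ => r • v) v r := fun r => by
    simpa using (hasDerivAt_id r).smul_const v
  have h1 : ∀ r : ℝ, HasDerivAt (fun r : ℝ => f (r • v)) (fderiv ℝ f (r • v) v) r := fun r =>
    ((hf.differentiable (by simp)) (r • v)).hasFDerivAt.comp_hasDerivAt r (hline r)
  have h2 : ∀ r : ℝ, HasDerivAt (fun r : ℝ => fderiv ℝ f (r • v) v)
      (fderiv ℝ (fderiv ℝ f) (r • v) v v) r := fun r => by
    have := ((hf'.differentiable (by simp)) (r • v)).hasFDerivAt.comp_hasDerivAt r (hline r)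
    simpa using this.clm_apply (hasDerivAt_const r v)
  have hc : Continuous fun r : ℝ => fderiv ℝ (fderiv ℝ f) (r • v) v v := by
    have := hf''.continuous
    fun_prop
  have hs1 : HasCompactSupport fun r : ℝ => fderiv ℝ f (r • v) v :=
    (hfs.fderiv_apply ℝ v).comp_smul_right hv
  have hs2 : HasCompactSupport fun r : ℝ => fderiv ℝ (fderiv ℝ f) (r • v) v v := by
    refine HasCompactSupport.comp_smul_right (g := fun x => fderiv ℝ (fderiv ℝ f) x v v) ?_ hv
    exact ((hfs.fderiv ℝ).fderiv ℝ).comp_left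
      (g := fun B : E →L[ℝ] E →L[ℝ] ℝ => B v v) (by simp)
  simpa using integral_Ioi_mul_second_deriv_eq h1 h2 hc (hfs.comp_smul_right hv) hs1 hs2

end Ray

section Kernel

variable {d : ℕ}

/-- The degree `2 - d` homogeneous kernel whose divergence is the averaged solution. -/
noncomputable def averagedKernel (χ : EuclideanSpace ℝ (Fin d) → ℝ) (w : EuclideanSpace ℝ (Fin d))
    (j l k : Fin d) (x : EuclideanSpace ℝ (Fin d)) : ℝ :=
  χ (‖x‖⁻¹ • x) * ((x j * x l * w k + x l * x k * w j - w l * x k * x j) / ‖x‖ ^ d)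

variable {χ : EuclideanSpace ℝ (Fin d) → ℝ} {w : EuclideanSpace ℝ (Fin d)}

theorem averagedKernel_symm (j l k : Fin d) :
    averagedKernel χ w j l k = averagedKernel χ w k l j := by
  funext x
  unfold averagedKernel
  congr 2
  ring

theorem abs_averagedKernel_numerator_le (hw : ‖w‖ = 1) (j l k : Fin d)
    (x : EuclideanSpace ℝ (Fin d)) :
    |x j * x l * w k + x l * x k * w j - w l * x k * x j| ≤ 3 * ‖x‖ ^ 2 := by
  have hx : ∀ i, |x i| ≤ ‖x‖ := fun i => by simpa using PiLp.norm_apply_le x i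
  have hw' : ∀ i, |w i| ≤ 1 := fun i => by simpa [hw] using PiLp.norm_apply_le w i
  have hterm : ∀ a b c : Fin d, |x a * x b * w c| ≤ ‖x‖ ^ 2 := by
    intro a b c
    rw [abs_mul, abs_mul]
    calc |x a| * |x b| * |w c| ≤ ‖x‖ * ‖x‖ * 1 := by
          gcongr
          exacts [hx a, hx b, hw' c]
      _ = ‖x‖ ^ 2 := by ring
  have h1 := abs_le.1 (hterm j l k)
  have h2 := abs_le.1 (hterm l k j)
  have h3 := abs_le.1 (hterm k j l)
  rw [abs_le]
  constructor <;> linarith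

theorem locallyIntegrable_averagedKernel (hd : d ≠ 0) (hχ : Continuous χ) (hw : ‖w‖ = 1)
    (j l k : Fin d) : LocallyIntegrable (averagedKernel χ w j l k) := by
  have : NeZero d := ⟨hd⟩
  obtain ⟨C, hC⟩ := (isCompact_closedBall
    (0 : EuclideanSpace ℝ (Fin d)) 1).exists_bound_of_continuousOn hχ.continuousOn
  have hloc := (locallyIntegrable_norm_sq_div_norm_pow_finrank
    (volume : Measure (EuclideanSpace ℝ (Fin d)))).smul (3 * C)
  rw [finrank_euclideanSpace_fin] at hloc
  refine hloc.mono ?_ (.of_forall fun x => ?_)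
  · have := hχ.measurable
    refine Measurable.aestronglyMeasurable ?_
    unfold averagedKernel
    fun_prop
  · have hx : ‖x‖⁻¹ • x ∈ closedBall (0 : EuclideanSpace ℝ (Fin d)) 1 := by
      rw [mem_closedBall_zero_iff, norm_smul, norm_inv, norm_norm]
      exact inv_mul_le_one
    have hCx := hC _ hx
    have hnum := abs_averagedKernel_numerator_le hw j l k x
    have hC0 : 0 ≤ C := (norm_nonneg _).trans hCx
    simp only [averagedKernel, Pi.smul_apply, smul_eq_mul]
    rw [norm_mul, norm_div, norm_pow, norm_norm, Real.norm_eq_abs (_ - _)]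
    refine le_trans ?_ (le_abs_self _)
    calc _ ≤ C * (3 * ‖x‖ ^ 2 / ‖x‖ ^ d) := by gcongr
      _ = _ := by ring

theorem averagedKernel_smul (j l k : Fin d) {c : ℝ} (hc : 0 < c)
    (x : EuclideanSpace ℝ (Fin d)) :
    averagedKernel χ w j l k (c • x) = (c ^ 2 / c ^ d) * averagedKernel χ w j l k x := by
  have hdir : ‖c • x‖⁻¹ • c • x = ‖x‖⁻¹ • x := by
    rw [norm_smul, Real.norm_of_nonneg hc.le, smul_smul]
    congr 1
    field_simp
  unfold averagedKernel
  rw [hdir, norm_smul, Real.norm_of_nonneg hc.le, mul_pow]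
  simp only [PiLp.smul_apply, smul_eq_mul]
  field_simp

theorem contDiffOn_averagedKernel (hχ : ContDiff ℝ (⊤ : ℕ∞) χ) (j l k : Fin d) :
    ContDiffOn ℝ (⊤ : ℕ∞) (averagedKernel χ w j l k) {(0 : EuclideanSpace ℝ (Fin d))}ᶜ := by
  have hnorm : ContDiffOn ℝ (⊤ : ℕ∞) (fun x : EuclideanSpace ℝ (Fin d) => ‖x‖)
      {(0 : EuclideanSpace ℝ (Fin d))}ᶜ :=
    fun x hx => (contDiffAt_norm ℝ hx).contDiffWithinAt
  have hcoord : ∀ i, ContDiffOn ℝ (⊤ : ℕ∞) (fun x : EuclideanSpace ℝ (Fin d) => x i)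
      {(0 : EuclideanSpace ℝ (Fin d))}ᶜ := fun i => by fun_prop
  have hne : ∀ x ∈ ({(0 : EuclideanSpace ℝ (Fin d))}ᶜ : Set _), ‖x‖ ≠ 0 :=
    fun x hx => norm_ne_zero_iff.2 hx
  unfold averagedKernel
  refine (hχ.comp_contDiffOn ((hnorm.inv hne).smul contDiffOn_id)).mul (ContDiffOn.div ?_
    (hnorm.pow d) fun x hx => pow_ne_zero _ (hne x hx))
  fun_prop

theorem averagedKernel_eventuallyEq_zero (j l k : Fin d) {x : EuclideanSpace ℝ (Fin d)}
    (hx : x ≠ 0)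
    (hχx : ‖x‖⁻¹ • x ∉ closure {ω : EuclideanSpace ℝ (Fin d) | ω ∈ sphere 0 1 ∧ χ ω ≠ 0}) :
    averagedKernel χ w j l k =ᶠ[𝓝 x] 0 := by
  have hcont : ContinuousAt (fun y : EuclideanSpace ℝ (Fin d) => ‖y‖⁻¹ • y) x :=
    (continuousAt_id.norm.inv₀ (norm_ne_zero_iff.2 hx)).smul continuousAt_id
  filter_upwards [hcont.eventually (isClosed_closure.isOpen_compl.mem_nhds hχx),
    isOpen_ne.mem_nhds hx] with y hy hy0
  have hys : ‖y‖⁻¹ • y ∈ sphere (0 : EuclideanSpace ℝ (Fin d)) 1 := by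
    rw [mem_sphere_zero_iff_norm, norm_smul, norm_inv, norm_norm,
      inv_mul_cancel₀ (norm_ne_zero_iff.2 hy0)]
  have hzero : χ (‖y‖⁻¹ • y) = 0 := by
    by_contra h
    exact hy (subset_closure ⟨hys, h⟩)
  simp [averagedKernel, hzero]

theorem fderiv_averagedKernel_smul (j l k : Fin d) {c : ℝ} (hc : 0 < c)
    (x : EuclideanSpace ℝ (Fin d)) :
    fderiv ℝ (averagedKernel χ w j l k) (c • x) =
      (c / c ^ d) • fderiv ℝ (averagedKernel χ w j l k) x := by
  have h := fderiv_comp_smul (𝕜 := ℝ) (f := averagedKernel χ w j l k) (x := x) c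
  have heq : (fun y => averagedKernel χ w j l k (c • y)) =
      (c ^ 2 / c ^ d) • averagedKernel χ w j l k :=
    funext fun y => averagedKernel_smul j l k hc y
  rw [heq, fderiv_const_smul_field, Pi.smul_apply] at h
  have h' := congrArg (fun T => c⁻¹ • T) h
  simp only [smul_smul, inv_mul_cancel₀ hc.ne', one_smul] at h'
  rw [← h']
  congr 1
  field_simp

/-- Expansion of a bilinear form in the standard basis. -/
theorem sum_sum_mul_apply_single_single
    (B : EuclideanSpace ℝ (Fin d) →L[ℝ] EuclideanSpace ℝ (Fin d) →L[ℝ] ℝ)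
    (u v : EuclideanSpace ℝ (Fin d)) :
    ∑ j : Fin d, ∑ l : Fin d,
      u l * v j * B (EuclideanSpace.single l 1) (EuclideanSpace.single j 1) = B u v := by
  have hexp : ∀ x : EuclideanSpace ℝ (Fin d), ∑ i, x i • EuclideanSpace.single i (1 : ℝ) = x :=
    fun x => by simpa using (EuclideanSpace.basisFun (Fin d) ℝ).sum_repr x
  conv_rhs => rw [← hexp u, ← hexp v]
  simp only [map_sum, map_smul, sum_apply, smul_apply,
    smul_eq_mul, Finset.mul_sum, mul_assoc]
  refine Finset.sum_congr rfl fun j _ => Finset.sum_congr rfl fun l _ => ?_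
  ring

/-- Contracting the kernel with a symmetric form leaves only its radial part. -/
theorem sum_sum_averagedKernel_mul
    (B : EuclideanSpace ℝ (Fin d) →L[ℝ] EuclideanSpace ℝ (Fin d) →L[ℝ] ℝ)
    (hB : ∀ u v, B u v = B v u) (k : Fin d) (x : EuclideanSpace ℝ (Fin d)) :
    ∑ j : Fin d, ∑ l : Fin d, averagedKernel χ w j l k x *
      B (EuclideanSpace.single l 1) (EuclideanSpace.single j 1) =
    χ (‖x‖⁻¹ • x) * (w k * B x x / ‖x‖ ^ d) := by
  have h1 := sum_sum_mul_apply_single_single B x x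
  have h2 := sum_sum_mul_apply_single_single B x w
  have h3 := sum_sum_mul_apply_single_single B w x
  have h : w k * B x x = w k * B x x + x k * B x w - x k * B w x := by rw [hB x w]; ring
  rw [h, ← h1, ← h2, ← h3]
  simp only [Finset.mul_sum, ← Finset.sum_add_distrib, ← Finset.sum_sub_distrib, Finset.sum_div]
  refine Finset.sum_congr rfl fun j _ => Finset.sum_congr rfl fun l _ => ?_
  unfold averagedKernel
  ring

theorem sum_sum_integral_averagedKernel_mul (hd : d ≠ 0) (hχ : Continuous χ) (hw : ‖w‖ = 1)
    {f : EuclideanSpace ℝ (Fin d) → ℝ} (hf : ContDiff ℝ (⊤ : ℕ∞) f) (hfs : HasCompactSupport f)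
    (k : Fin d) :
    ∑ j : Fin d, ∑ l : Fin d, ∫ x, averagedKernel χ w j l k x *
      fderiv ℝ (fun y => fderiv ℝ f y (EuclideanSpace.single j 1)) x (EuclideanSpace.single l 1) =
    (∫ ω : sphere (0 : EuclideanSpace ℝ (Fin d)) 1, χ ω
      ∂(volume : Measure (EuclideanSpace ℝ (Fin d))).toSphere) * (w k * f 0) := by
  have : NeZero d := ⟨hd⟩
  have hf' : ContDiff ℝ (⊤ : ℕ∞) (fderiv ℝ f) := hf.fderiv_right (by simp)
  have hf'' : ContDiff ℝ (⊤ : ℕ∞) (fderiv ℝ (fderiv ℝ f)) := hf'.fderiv_right (by simp)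
  have hsymm : ∀ x u v, fderiv ℝ (fderiv ℝ f) x u v = fderiv ℝ (fderiv ℝ f) x v u :=
    fun x u v => (hf.contDiffAt.isSymmSndFDerivAt (by simpa using ENat.LEInfty.out)) u v
  have happly : ∀ x u v, fderiv ℝ (fun y => fderiv ℝ f y v) x u =
      fderiv ℝ (fderiv ℝ f) x u v := by
    intro x u v
    rw [fderiv_clm_apply (hf'.differentiable (by simp) x) (differentiableAt_const v)]
    simp
  simp only [happly]
  have hint : ∀ j l, Integrable fun x => averagedKernel χ w j l k x *
      fderiv ℝ (fderiv ℝ f) x (EuclideanSpace.single l 1) (EuclideanSpace.single j 1) := by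
    intro j l
    have hc : Continuous fun x => fderiv ℝ (fderiv ℝ f) x
        (EuclideanSpace.single l 1) (EuclideanSpace.single j 1) := by
      have := hf''.continuous
      fun_prop
    have hs : HasCompactSupport fun x => fderiv ℝ (fderiv ℝ f) x
        (EuclideanSpace.single l 1) (EuclideanSpace.single j 1) :=
      ((hfs.fderiv ℝ).fderiv ℝ).comp_left
        (g := fun B : EuclideanSpace ℝ (Fin d) →L[ℝ] EuclideanSpace ℝ (Fin d) →L[ℝ] ℝ =>
          B (EuclideanSpace.single l 1) (EuclideanSpace.single j 1)) (by simp)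
    simpa [mul_comm] using (locallyIntegrable_averagedKernel hd hχ hw
      j l k).integrable_smul_left_of_hasCompactSupport hc hs
  have hsum : Integrable fun x => χ (‖x‖⁻¹ • x) *
      (w k * fderiv ℝ (fderiv ℝ f) x x x / ‖x‖ ^ d) := by
    simp only [← sum_sum_averagedKernel_mul _ (hsymm _)]
    exact integrable_finsetSum _ fun j _ => integrable_finsetSum _ fun l _ => hint j l
  have hswap : ∑ j : Fin d, ∑ l : Fin d, ∫ x, averagedKernel χ w j l k x *
      fderiv ℝ (fderiv ℝ f) x (EuclideanSpace.single l 1) (EuclideanSpace.single j 1) =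
      ∫ x, χ (‖x‖⁻¹ • x) * (w k * fderiv ℝ (fderiv ℝ f) x x x / ‖x‖ ^ d) := by
    simp only [← sum_sum_averagedKernel_mul _ (hsymm _)]
    rw [integral_finsetSum _ fun j _ => integrable_finsetSum _ fun l _ => hint j l]
    exact Finset.sum_congr rfl fun j _ => (integral_finsetSum _ fun l _ => hint j l).symm
  rw [hswap, integral_eq_integral_toSphere_integral_Ioi _ hsum, ← integral_mul_const]
  congr 1 with ω
  have hω : ‖(ω : EuclideanSpace ℝ (Fin d))‖ = 1 := mem_sphere_zero_iff_norm.1 ω.2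
  have hω0 : (ω : EuclideanSpace ℝ (Fin d)) ≠ 0 := norm_ne_zero_iff.1 (by simp [hω])
  rw [← integral_Ioi_mul_second_fderiv_ray hf hfs hω0, ← mul_assoc, ← integral_const_mul]
  refine setIntegral_congr_fun measurableSet_Ioi fun r hr => ?_
  have hr0 : 0 < r := hr
  obtain ⟨n, rfl⟩ := Nat.exists_eq_succ_of_ne_zero hd
  simp only [finrank_euclideanSpace_fin, Nat.succ_eq_add_one, Nat.add_sub_cancel, norm_smul, hω,
    Real.norm_of_nonneg hr0.le, mul_one, smul_smul, inv_mul_cancel₀ hr0.ne', one_smul, map_smul,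
    smul_apply, smul_eq_mul]
  field_simp
  ring

end Kernel

/-- `L_{χ,w}^{jk} = ∂_l ( χ(x/|x|)(x^j x^l w^k + x^l x^k w^j − w^l x^k x^j)/|x|^d )`
is a symmetric-2-tensor-valued distribution with `∂_j L_{χ,w}^{jk} = δ_0 w^k`; it is
homogeneous of degree `1 − d`, smooth on `ℝ^d \ {0}`, and supported in the closed cone
over `supp χ`. The distributional pairings are expressed by integration by parts against
the locally integrable, degree `2−d` homogeneous kernel `F`. -/
theorem averaged_symmetric_divergence_fundamental_solution
    (d : ℕ) (hd : 2 ≤ d) (χ : EuclideanSpace ℝ (Fin d) → ℝ) (hχ : ContDiff ℝ (⊤ : ℕ∞) χ)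
    (hint : ∫ ω : Metric.sphere (0 : EuclideanSpace ℝ (Fin d)) 1, χ ω
        ∂((volume : Measure (EuclideanSpace ℝ (Fin d))).toSphere) = 1)
    (w : EuclideanSpace ℝ (Fin d)) (hw : ‖w‖ = 1)
    (F : Fin d → Fin d → Fin d → EuclideanSpace ℝ (Fin d) → ℝ)
    (hF : F = fun j l k x => χ (‖x‖⁻¹ • x) *
        ((x j * x l * w k + x l * x k * w j - w l * x k * x j) / ‖x‖ ^ d))
    (L : Fin d → Fin d → EuclideanSpace ℝ (Fin d) → ℝ)
    (hL : L = fun j k x => ∑ l : Fin d, fderiv ℝ (F j l k) x (EuclideanSpace.single l 1)) :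
    -- symmetry of the tensor
    (∀ j l k, F j l k = F k l j) ∧
    -- local integrability of the kernel F (so that the distribution L = ∂_l F is defined)
    (∀ j l k, LocallyIntegrable (F j l k)) ∧
    -- ∂_j L^{jk} = δ_0 w^k in the sense of distributions
    (∀ f : EuclideanSpace ℝ (Fin d) → ℝ, ContDiff ℝ (⊤ : ℕ∞) f → HasCompactSupport f →
      ∀ k : Fin d,
        ∑ j : Fin d, ∑ l : Fin d,
          ∫ x : EuclideanSpace ℝ (Fin d), F j l k x *
            fderiv ℝ (fun y => fderiv ℝ f y (EuclideanSpace.single j 1)) x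
              (EuclideanSpace.single l 1)
        = w k * f 0) ∧
    -- homogeneity of degree 1 − d away from the origin
    (∀ j k, ∀ x : EuclideanSpace ℝ (Fin d), x ≠ 0 → ∀ lam : ℝ, 0 < lam →
        L j k (lam • x) = lam ^ ((1:ℝ) - d) * L j k x) ∧
    -- smoothness away from the origin
    (∀ j k, ContDiffOn ℝ (⊤ : ℕ∞) (L j k) {(0 : EuclideanSpace ℝ (Fin d))}ᶜ) ∧
    -- support in the closed cone over supp χ
    (∀ j k, ∀ x : EuclideanSpace ℝ (Fin d), x ≠ 0 → L j k x ≠ 0 →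
        ‖x‖⁻¹ • x ∈ closure {ω : EuclideanSpace ℝ (Fin d) |
          ω ∈ Metric.sphere (0:EuclideanSpace ℝ (Fin d)) 1 ∧ χ ω ≠ 0}) := by
  have hFk : F = averagedKernel χ w := hF
  subst hFk
  subst hL
  refine ⟨averagedKernel_symm, locallyIntegrable_averagedKernel (by omega) hχ.continuous hw, ?_,
    ?_, ?_, ?_⟩
  · intro f hf hfs k
    rw [sum_sum_integral_averagedKernel_mul (by omega) hχ.continuous hw hf hfs k, hint, one_mul]
  · intro j k x _ lam hlam
    simp only [fderiv_averagedKernel_smul _ _ _ hlam, smul_apply, smul_eq_mul,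
      ← Finset.mul_sum]
    rw [Real.rpow_sub hlam, Real.rpow_one, Real.rpow_natCast]
  · intro j k
    exact ContDiffOn.sum fun l _ => ((contDiffOn_averagedKernel hχ j l k).fderiv_of_isOpen
      isOpen_compl_singleton (by simp)).clm_apply contDiffOn_const
  · intro j k x hx hne
    by_contra hcl
    refine hne (Finset.sum_eq_zero fun l _ => ?_)
    rw [(averagedKernel_eventuallyEq_zero j l k hx hcl).fderiv_eq]
    simp
end

section
/- Let 0 < α ≤ 1, s ∈ ℕ with s > d/2, δ₁, δ₂ ∈ ℝ. Then pointwise multiplication is bounded on anisotropic spaces supported in Ω = {|x'| ≤ x_d^α, x_d ≥ 1}: ‖gh‖_{H^{s, δ₁+δ₂+((d−1)α+1)/2}_α} ≲ ‖g‖_{H^{s,δ₁}_α} ‖h‖_{H^{s,δ₂}_α} for all g, h ∈ C_c^∞(Ω). -/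
open MeasureTheory

noncomputable section

/-- Japanese bracket `⟨x⟩ = (1+|x|²)^{1/2}`. -/
def jap {d : ℕ} (x : EuclideanSpace ℝ (Fin d)) : ℝ := Real.sqrt (1 + ‖x‖ ^ 2)

variable {m : ℕ}

/-- Partial derivative `∂_i`. -/
def pdOp (i : Fin (m + 1)) (u : EuclideanSpace ℝ (Fin (m + 1)) → ℝ) :
    EuclideanSpace ℝ (Fin (m + 1)) → ℝ :=
  fun x => fderiv ℝ u x (EuclideanSpace.single i 1)

/-- Multi-index derivative `∂^β = ∂_{x'}^{β'} ∂_{x_d}^{β_d}`. -/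
def mderiv (β : Fin (m + 1) → ℕ) (u : EuclideanSpace ℝ (Fin (m + 1)) → ℝ) :
    EuclideanSpace ℝ (Fin (m + 1)) → ℝ :=
  (List.finRange (m + 1)).foldr (fun i v => (pdOp i)^[β i] v) u

/-- Anisotropic weight `|β'|α + β_d + δ` for a multi-index `β = (β', β_d)`. -/
def aweight (m : ℕ) (α δ : ℝ) (β : Fin (m + 1) → ℕ) : ℝ :=
  ((∑ i : Fin m, β i.castSucc : ℕ) : ℝ) * α + (β (Fin.last m) : ℝ) + δ

/-- Anisotropic weighted Sobolev norm
`‖u‖²_{H^{s,δ}_α} = Σ_{|β|≤s} ‖⟨x⟩^{|β'|α+β_d+δ} ∂^β u‖²_{L²}`. -/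
def anisoNorm (m s : ℕ) (α δ : ℝ) (u : EuclideanSpace ℝ (Fin (m + 1)) → ℝ) : ℝ :=
  Real.sqrt (∑ β : Fin (m + 1) → Fin (s + 1),
    if (∑ i, ((β i : ℕ))) ≤ s then
      ∫ x : EuclideanSpace ℝ (Fin (m + 1)),
        (jap x ^ aweight m α δ (fun i => (β i : ℕ)) * mderiv (fun i => (β i : ℕ)) u x) ^ 2
    else 0)

/-- The degenerate sector `Ω = {(x',x_d) : |x'| ≤ x_d^α, x_d ≥ 1}` (with `d = m+1`). -/
def degSector (m : ℕ) (α : ℝ) : Set (EuclideanSpace ℝ (Fin (m + 1))) :=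
  {x | Real.sqrt (∑ i : Fin m, x i.castSucc ^ 2) ≤ x (Fin.last m) ^ α ∧ 1 ≤ x (Fin.last m)}

open scoped ENNReal FourierTransform ContDiff

/-- Smooth, compactly supported real-valued functions. -/
def IsTest (u : EuclideanSpace ℝ (Fin (m + 1)) → ℝ) : Prop :=
  ContDiff ℝ ∞ u ∧ HasCompactSupport u

lemma contDiff_pdOp {u : EuclideanSpace ℝ (Fin (m + 1)) → ℝ} (hu : ContDiff ℝ ∞ u)
    (i : Fin (m + 1)) : ContDiff ℝ ∞ (pdOp i u) :=
  (hu.fderiv_right (m := ∞) (by simp)).clm_apply contDiff_const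

lemma contDiff_pdOp_iterate {u : EuclideanSpace ℝ (Fin (m + 1)) → ℝ} (hu : ContDiff ℝ ∞ u)
    (i : Fin (m + 1)) (n : ℕ) : ContDiff ℝ ∞ ((pdOp i)^[n] u) := by
  induction n with
  | zero => exact hu
  | succ n ih => rw [Function.iterate_succ_apply']; exact contDiff_pdOp ih i

lemma tsupport_pdOp_subset (u : EuclideanSpace ℝ (Fin (m + 1)) → ℝ) (i : Fin (m + 1)) :
    tsupport (pdOp i u) ⊆ tsupport u :=
  tsupport_fderiv_apply_subset ℝ _

/-- A property stable under every `∂_i` is stable under every `∂^β`. -/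
lemma mderiv_induction {P : (EuclideanSpace ℝ (Fin (m + 1)) → ℝ) → Prop}
    (hP : ∀ i u, P u → P (pdOp i u)) (β : Fin (m + 1) → ℕ)
    {u : EuclideanSpace ℝ (Fin (m + 1)) → ℝ} (hu : P u) : P (mderiv β u) := by
  unfold mderiv
  induction List.finRange (m + 1) with
  | nil => exact hu
  | cons i l ih =>
    rw [List.foldr_cons]
    generalize List.foldr (fun i v => (pdOp i)^[β i] v) u l = v at ih
    induction β i with
    | zero => exact ih
    | succ n ihn => rw [Function.iterate_succ_apply']; exact hP i _ ihn

lemma IsTest.isTest_pdOp {u : EuclideanSpace ℝ (Fin (m + 1)) → ℝ} (hu : IsTest u)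
    (i : Fin (m + 1)) :
    IsTest (pdOp i u) :=
  ⟨contDiff_pdOp hu.1 i, hu.2.of_isClosed_subset (isClosed_tsupport _)
    (tsupport_pdOp_subset u i)⟩

lemma IsTest.isTest_mderiv {u : EuclideanSpace ℝ (Fin (m + 1)) → ℝ} (hu : IsTest u)
    (β : Fin (m + 1) → ℕ) : IsTest (mderiv β u) :=
  mderiv_induction (P := IsTest) (fun i _ h => h.isTest_pdOp i) β hu

lemma IsTest.mul {u v : EuclideanSpace ℝ (Fin (m + 1)) → ℝ} (hu : IsTest u) (hv : IsTest v) :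
    IsTest (fun x => u x * v x) :=
  ⟨hu.1.mul hv.1, hu.2.mul_right⟩

lemma tsupport_mderiv_subset (β : Fin (m + 1) → ℕ) (u : EuclideanSpace ℝ (Fin (m + 1)) → ℝ) :
    tsupport (mderiv β u) ⊆ tsupport u :=
  mderiv_induction (P := fun v => tsupport v ⊆ tsupport u)
    (fun i v h => (tsupport_pdOp_subset v i).trans h) β subset_rfl

/-- The complex-valued Schwartz function attached to a real test function. -/
def IsTest.toSchwartz {u : EuclideanSpace ℝ (Fin (m + 1)) → ℝ} (hu : IsTest u) :
    SchwartzMap (EuclideanSpace ℝ (Fin (m + 1))) ℂ :=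
  HasCompactSupport.toSchwartzMap (f := fun x => (u x : ℂ))
    (hu.2.comp_left (g := fun r : ℝ => (r : ℂ)) Complex.ofReal_zero)
    (Complex.ofRealCLM.contDiff.comp hu.1)

lemma IsTest.toSchwartz_apply {u : EuclideanSpace ℝ (Fin (m + 1)) → ℝ} (hu : IsTest u)
    (x : EuclideanSpace ℝ (Fin (m + 1))) : hu.toSchwartz x = (u x : ℂ) := rfl

/-- The inverse Fourier transform of a real-valued function. -/
def invFourier (u : EuclideanSpace ℝ (Fin (m + 1)) → ℝ) : EuclideanSpace ℝ (Fin (m + 1)) → ℂ :=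
  𝓕⁻ (fun x => (u x : ℂ))

lemma IsTest.coe_fourierInv_toSchwartz {u : EuclideanSpace ℝ (Fin (m + 1)) → ℝ}
    (hu : IsTest u) :
    ⇑(𝓕⁻ hu.toSchwartz : SchwartzMap (EuclideanSpace ℝ (Fin (m + 1))) ℂ) = invFourier u := by
  ext x
  rw [SchwartzMap.fourierInv_coe]
  rfl

lemma IsTest.measurable_enorm_invFourier {u : EuclideanSpace ℝ (Fin (m + 1)) → ℝ}
    (hu : IsTest u) : Measurable fun ξ => ‖invFourier u ξ‖ₑ := by
  rw [← hu.coe_fourierInv_toSchwartz]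
  exact (SchwartzMap.continuous _).enorm.measurable

lemma lintegral_enorm_sq_eq_ofReal (f : SchwartzMap (EuclideanSpace ℝ (Fin (m + 1))) ℂ) :
    ∫⁻ x, ‖f x‖ₑ ^ 2 = ENNReal.ofReal (∫ x, ‖f x‖ ^ 2) := by
  rw [ofReal_integral_eq_lintegral_ofReal
      (by simpa using (f.memLp 2).integrable_norm_pow two_ne_zero)
    (.of_forall fun x => by positivity)]
  simp [ENNReal.ofReal_pow]

/-- The Plancherel identity for test functions. -/
lemma IsTest.lintegral_invFourier {u : EuclideanSpace ℝ (Fin (m + 1)) → ℝ} (hu : IsTest u) :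
    ∫⁻ ξ, ‖invFourier u ξ‖ₑ ^ 2 = ∫⁻ x, ‖u x‖ₑ ^ 2 := by
  have h := SchwartzMap.integral_norm_sq_fourier
    (𝓕⁻ hu.toSchwartz : SchwartzMap (EuclideanSpace ℝ (Fin (m + 1))) ℂ)
  rw [FourierTransform.fourier_fourierInv_eq] at h
  rw [← hu.coe_fourierInv_toSchwartz, lintegral_enorm_sq_eq_ofReal, ← h,
    ← lintegral_enorm_sq_eq_ofReal]
  simp [IsTest.toSchwartz_apply, enorm_eq_nnnorm]

lemma IsTest.enorm_invFourier_pdOp {u : EuclideanSpace ℝ (Fin (m + 1)) → ℝ} (hu : IsTest u)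
    (i : Fin (m + 1)) (ξ : EuclideanSpace ℝ (Fin (m + 1))) :
    ‖invFourier (pdOp i u) ξ‖ₑ = ‖2 * Real.pi * ξ i‖ₑ * ‖invFourier u ξ‖ₑ := by
  have h := SchwartzMap.fourierInv_lineDerivOp_eq hu.toSchwartz (EuclideanSpace.single i 1)
  have hd : LineDeriv.lineDerivOp (EuclideanSpace.single i (1 : ℝ)) hu.toSchwartz
      = (hu.isTest_pdOp i).toSchwartz := by
    ext x
    rw [SchwartzMap.lineDerivOp_apply_eq_fderiv, IsTest.toSchwartz_apply]
    have := ((hu.1.differentiable (by simp)) x).hasFDerivAt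
    have h2 := Complex.ofRealCLM.hasFDerivAt.comp x this
    exact congrArg (fun L => L (EuclideanSpace.single i 1)) h2.fderiv
  rw [hd] at h
  have h3 := congrArg (fun f : SchwartzMap _ ℂ => f ξ) h
  have ht : (fun y : EuclideanSpace ℝ (Fin (m + 1)) =>
    inner ℝ y (EuclideanSpace.single i (1 : ℝ))).HasTemperateGrowth := by fun_prop
  simp only [smul_apply, SchwartzMap.smulLeftCLM_apply_apply ht,
    IsTest.coe_fourierInv_toSchwartz] at h3
  have hi : inner ℝ ξ (EuclideanSpace.single i (1 : ℝ)) = ξ i := by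
    simp [EuclideanSpace.inner_single_right]
  rw [h3, hi]
  simp only [enorm_mul, enorm_smul, enorm_neg, mul_assoc]
  simp [← ofReal_norm, abs_of_pos Real.pi_pos]

lemma IsTest.enorm_invFourier_mul_le {u v : EuclideanSpace ℝ (Fin (m + 1)) → ℝ} (hu : IsTest u)
    (hv : IsTest v) (ξ : EuclideanSpace ℝ (Fin (m + 1))) :
    ‖invFourier (fun x => u x * v x) ξ‖ₑ
      ≤ ∫⁻ t, ‖invFourier u t‖ₑ * ‖invFourier v (ξ - t)‖ₑ := by
  have h := SchwartzMap.convolution_apply (ContinuousLinearMap.mul ℂ ℂ) (𝓕⁻ hu.toSchwartz)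
    (𝓕⁻ hv.toSchwartz) ξ
  have h2 : SchwartzMap.convolution (ContinuousLinearMap.mul ℂ ℂ) (𝓕⁻ hu.toSchwartz)
    (𝓕⁻ hv.toSchwartz) = 𝓕⁻ (hu.mul hv).toSchwartz := by
    rw [← FourierTransform.fourierInv_fourier_eq
      (F := SchwartzMap (EuclideanSpace ℝ (Fin (m + 1))) ℂ) (SchwartzMap.convolution _ _ _),
      SchwartzMap.fourier_convolution]
    congr 1
    ext x
    simp [SchwartzMap.pairing_apply_apply, IsTest.toSchwartz_apply]
  rw [h2, IsTest.coe_fourierInv_toSchwartz, IsTest.coe_fourierInv_toSchwartz,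
    IsTest.coe_fourierInv_toSchwartz, convolution_def] at h
  rw [h]
  refine (enorm_integral_le_lintegral_enorm _).trans (le_of_eq ?_)
  simp [enorm_mul]

lemma ENNReal.add_pow_le_two_pow_mul (a b : ℝ≥0∞) (n : ℕ) :
    (a + b) ^ n ≤ 2 ^ n * (a ^ n + b ^ n) := by
  wlog hab : a ≤ b generalizing a b
  · rw [add_comm a, add_comm (a ^ n)]
    exact this b a (le_of_not_ge hab)
  calc (a + b) ^ n ≤ (2 * b) ^ n := by rw [two_mul]; gcongr
    _ = 2 ^ n * b ^ n := mul_pow _ _ _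
    _ ≤ _ := by gcongr; exact le_add_self

lemma ENNReal.sum_pow_le_card_pow_mul {ι : Type*} [Fintype ι] [Nonempty ι] (a : ι → ℝ≥0∞)
    (n : ℕ) : (∑ i, a i) ^ n ≤ (Fintype.card ι : ℝ≥0∞) ^ n * ∑ i, a i ^ n := by
  obtain ⟨j, -, hj⟩ := Finset.exists_max_image Finset.univ a Finset.univ_nonempty
  calc (∑ i, a i) ^ n ≤ (Fintype.card ι * a j) ^ n := by
        gcongr
        simpa using Finset.sum_le_card_nsmul Finset.univ a (a j) hj
    _ = (Fintype.card ι : ℝ≥0∞) ^ n * a j ^ n := mul_pow _ _ _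
    _ ≤ _ := by
        gcongr
        exact Finset.single_le_sum (f := fun i => a i ^ n) (fun _ _ => zero_le)
          (Finset.mem_univ j)

/-- The Cauchy–Schwarz inequality for lower Lebesgue integrals. -/
lemma lintegral_mul_sq_le {X : Type*} [MeasurableSpace X] {μ : Measure X} {f g : X → ℝ≥0∞}
    (hf : AEMeasurable f μ) (hg : AEMeasurable g μ) :
    (∫⁻ x, f x * g x ∂μ) ^ 2 ≤ (∫⁻ x, f x ^ 2 ∂μ) * ∫⁻ x, g x ^ 2 ∂μ := by
  have h := ENNReal.lintegral_mul_le_Lp_mul_Lq μ Real.HolderConjugate.two_two hf hg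
  have hsq : ∀ c : ℝ≥0∞, (c ^ (1 / 2 : ℝ)) ^ 2 = c := fun c => by
    rw [← ENNReal.rpow_natCast, ← ENNReal.rpow_mul]; simp
  simp only [ENNReal.rpow_ofNat] at h
  calc (∫⁻ x, f x * g x ∂μ) ^ 2
      ≤ ((∫⁻ x, f x ^ 2 ∂μ) ^ (1 / 2 : ℝ) * (∫⁻ x, g x ^ 2 ∂μ) ^ (1 / 2 : ℝ)) ^ 2 := by
        gcongr; exact h
    _ = _ := by rw [mul_pow, hsq, hsq]

/-- A weighted `L²` bound for convolutions: if the weight satisfies `P ξ ≲ P t + P (ξ - t)` and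
`P⁻¹` is integrable, then `L²(P)` is stable under convolution. -/
lemma lintegral_weight_mul_conv_sq_le {P φ ψ : EuclideanSpace ℝ (Fin (m + 1)) → ℝ≥0∞} {A : ℝ≥0∞}
    (hP : Measurable P) (hφ : Measurable φ) (hψ : Measurable ψ)
    (hP0 : ∀ ξ, P ξ ≠ 0) (hPt : ∀ ξ, P ξ ≠ ⊤)
    (hA : ∀ ξ t, P ξ ≤ A * (P t + P (ξ - t))) :
    ∫⁻ ξ, P ξ * (∫⁻ t, φ t * ψ (ξ - t)) ^ 2
      ≤ 2 * A * (∫⁻ ξ, (P ξ)⁻¹) * (∫⁻ ξ, P ξ * φ ξ ^ 2) * ∫⁻ ξ, P ξ * ψ ξ ^ 2 := by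
  set J := ∫⁻ ξ, (P ξ)⁻¹
  set Q : EuclideanSpace ℝ (Fin (m + 1)) → ℝ≥0∞ := fun ξ => P ξ ^ (1 / 2 : ℝ) with hQdef
  have hQ : Measurable Q := hP.pow_const _
  have hQsq : ∀ ξ, Q ξ ^ 2 = P ξ := fun ξ => by
    rw [hQdef, ← ENNReal.rpow_natCast, ← ENNReal.rpow_mul]; simp
  have hQ0 : ∀ ξ, Q ξ ≠ 0 := fun ξ h => hP0 ξ (by rw [← hQsq, h]; simp)
  have hQt : ∀ ξ, Q ξ ≠ ⊤ := fun ξ h => hPt ξ (by rw [← hQsq, h]; simp)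
  have hkernel : ∀ ξ, P ξ * ∫⁻ t, ((Q t * Q (ξ - t))⁻¹) ^ 2 ≤ 2 * A * J := by
    intro ξ
    rw [← lintegral_const_mul _ (by fun_prop)]
    calc ∫⁻ t, P ξ * ((Q t * Q (ξ - t))⁻¹) ^ 2
        ≤ ∫⁻ t, A * ((P (ξ - t))⁻¹ + (P t)⁻¹) := by
          refine lintegral_mono fun t => ?_
          calc P ξ * ((Q t * Q (ξ - t))⁻¹) ^ 2
              ≤ A * (P t + P (ξ - t)) * (P t * P (ξ - t))⁻¹ := by
                rw [← ENNReal.inv_pow, mul_pow, hQsq, hQsq]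
                gcongr
                exact hA ξ t
            _ = A * ((P t * (P t)⁻¹) * (P (ξ - t))⁻¹ + (P (ξ - t) * (P (ξ - t))⁻¹) * (P t)⁻¹) := by
                rw [ENNReal.mul_inv (.inl (hP0 t)) (.inl (hPt t))]
                ring
            _ = _ := by
                rw [ENNReal.mul_inv_cancel (hP0 _) (hPt _), ENNReal.mul_inv_cancel (hP0 _) (hPt _)]
                ring
      _ = 2 * A * J := by
          rw [lintegral_const_mul _ (by fun_prop), lintegral_add_left (by fun_prop),
            lintegral_sub_left_eq_self (fun t => (P t)⁻¹) ξ]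
          ring
  calc ∫⁻ ξ, P ξ * (∫⁻ t, φ t * ψ (ξ - t)) ^ 2
      ≤ ∫⁻ ξ, 2 * A * J * ∫⁻ t, (P t * φ t ^ 2) * (P (ξ - t) * ψ (ξ - t) ^ 2) := by
        refine lintegral_mono fun ξ => ?_
        have hfac : ∀ t, φ t * ψ (ξ - t)
            = (Q t * φ t * (Q (ξ - t) * ψ (ξ - t))) * (Q t * Q (ξ - t))⁻¹ := fun t => by
          rw [ENNReal.mul_inv (.inl (hQ0 t)) (.inl (hQt t))]
          calc φ t * ψ (ξ - t) = (Q t * (Q t)⁻¹) * (Q (ξ - t) * (Q (ξ - t))⁻¹)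
                * (φ t * ψ (ξ - t)) := by
                rw [ENNReal.mul_inv_cancel (hQ0 _) (hQt _), ENNReal.mul_inv_cancel (hQ0 _) (hQt _)]
                ring
            _ = _ := by ring
        simp_rw [hfac]
        calc P ξ * (∫⁻ t, (Q t * φ t * (Q (ξ - t) * ψ (ξ - t))) * (Q t * Q (ξ - t))⁻¹) ^ 2
            ≤ P ξ * ((∫⁻ t, (Q t * φ t * (Q (ξ - t) * ψ (ξ - t))) ^ 2)
                * ∫⁻ t, ((Q t * Q (ξ - t))⁻¹) ^ 2) := by
              gcongr
              exact lintegral_mul_sq_le (by fun_prop) (by fun_prop)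
          _ = (P ξ * ∫⁻ t, ((Q t * Q (ξ - t))⁻¹) ^ 2)
                * ∫⁻ t, (Q t * φ t * (Q (ξ - t) * ψ (ξ - t))) ^ 2 := by ring
          _ ≤ 2 * A * J * ∫⁻ t, (P t * φ t ^ 2) * (P (ξ - t) * ψ (ξ - t) ^ 2) := by
              gcongr ?_ * ?_
              · exact hkernel ξ
              · exact (lintegral_congr fun t => by simp only [mul_pow, hQsq]).le
    _ = 2 * A * J * ∫⁻ t, ∫⁻ ξ, (P t * φ t ^ 2) * (P (ξ - t) * ψ (ξ - t) ^ 2) := by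
        rw [lintegral_const_mul _ (Measurable.lintegral_prod_right' (f := fun p :
          EuclideanSpace ℝ (Fin (m + 1)) × EuclideanSpace ℝ (Fin (m + 1)) =>
          (P p.2 * φ p.2 ^ 2) * (P (p.1 - p.2) * ψ (p.1 - p.2) ^ 2)) (by fun_prop)),
          lintegral_lintegral_swap (by fun_prop)]
    _ = _ := by
        have hin : ∀ t, ∫⁻ ξ, (P t * φ t ^ 2) * (P (ξ - t) * ψ (ξ - t) ^ 2)
            = (P t * φ t ^ 2) * ∫⁻ ξ, P ξ * ψ ξ ^ 2 := fun t => by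
          rw [lintegral_const_mul _ (by fun_prop),
            lintegral_sub_right_eq_self (fun ξ => P ξ * ψ ξ ^ 2) t]
        simp_rw [hin]
        rw [lintegral_mul_const _ (by fun_prop)]
        ring

/-- The Fourier symbol `1 + Σ |2π ℓ_i ξ_i|²`. -/
def scaledSymbol (ℓ : Fin (m + 1) → ℝ) (ξ : EuclideanSpace ℝ (Fin (m + 1))) : ℝ≥0∞ :=
  1 + ∑ i, ‖ℓ i * (2 * Real.pi * ξ i)‖ₑ ^ 2

lemma lintegral_inv_scaledSymbol_pow (ℓ : Fin (m + 1) → ℝ) (hℓ : ∀ i, 0 < ℓ i) (s : ℕ) :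
    ∫⁻ ξ, (scaledSymbol ℓ ξ ^ s)⁻¹ = ENNReal.ofReal (∏ i, (ℓ i * (2 * Real.pi)))⁻¹
      * ∫⁻ ξ : EuclideanSpace ℝ (Fin (m + 1)), ((1 + ‖ξ‖ₑ ^ 2) ^ s)⁻¹ := by
  set b := (EuclideanSpace.basisFun (Fin (m + 1)) ℝ).toBasis
  set f := Matrix.toLin b b (Matrix.diagonal fun i => ℓ i * (2 * Real.pi)) with hf
  have hdet : LinearMap.det f = ∏ i, (ℓ i * (2 * Real.pi)) := by
    rw [hf, LinearMap.det_toLin, Matrix.det_diagonal]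
  have hpos : 0 < ∏ i, (ℓ i * (2 * Real.pi)) :=
    Finset.prod_pos fun i _ => mul_pos (hℓ i) Real.two_pi_pos
  have hfa : ∀ ξ i, f ξ i = ℓ i * (2 * Real.pi * ξ i) := fun ξ i => by
    have := congrFun (LinearMap.toMatrix_mulVec_repr b b f ξ) i
    rw [hf, LinearMap.toMatrix_toLin, ← hf] at this
    have h2 : b.repr (f ξ) i = f ξ i := by simp [b]
    rw [← h2, ← this, Matrix.mulVec_diagonal]
    simp [b, mul_assoc]
  have hsym : ∀ ξ, scaledSymbol ℓ ξ = 1 + ‖f ξ‖ₑ ^ 2 := fun ξ => by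
    have h1 : ‖f ξ‖ₑ ^ 2 = ENNReal.ofReal (‖f ξ‖ ^ 2) := by
      rw [ENNReal.ofReal_pow (norm_nonneg _), ofReal_norm]
    rw [h1, EuclideanSpace.norm_sq_eq, ENNReal.ofReal_sum_of_nonneg fun _ _ => by positivity]
    unfold scaledSymbol
    congr 1
    refine Finset.sum_congr rfl fun i _ => ?_
    rw [ENNReal.ofReal_pow (norm_nonneg _), ofReal_norm, hfa]
  simp_rw [hsym]
  have hfm : Measurable f := f.continuous_of_finiteDimensional.measurable
  rw [← lintegral_map (f := fun ξ : EuclideanSpace ℝ (Fin (m + 1)) => ((1 + ‖ξ‖ₑ ^ 2) ^ s)⁻¹)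
    (by fun_prop) hfm, Measure.map_linearMap_addHaar_eq_smul_addHaar _ (by rw [hdet]; exact hpos.ne'),
    lintegral_smul_measure, hdet, abs_of_pos (inv_pos.2 hpos), smul_eq_mul]

lemma lintegral_inv_one_add_enorm_sq_pow_ne_top {s : ℕ} (hs : ((m : ℝ) + 1) / 2 < s) :
    ∫⁻ ξ : EuclideanSpace ℝ (Fin (m + 1)), ((1 + ‖ξ‖ₑ ^ 2) ^ s)⁻¹ ≠ ⊤ := by
  have h := (integrable_rpow_neg_one_add_norm_sq (E := EuclideanSpace ℝ (Fin (m + 1)))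
    (μ := volume) (r := 2 * s) (by simp; linarith)).lintegral_lt_top
  convert h.ne using 3 with ξ
  have h1 : (0 : ℝ) < 1 + ‖ξ‖ ^ 2 := by positivity
  rw [show -(2 * (s : ℝ)) / 2 = -(s : ℝ) by ring, Real.rpow_neg h1.le, Real.rpow_natCast,
    ENNReal.ofReal_inv_of_pos (by positivity), ENNReal.ofReal_pow h1.le,
    ENNReal.ofReal_add zero_le_one (by positivity), ENNReal.ofReal_pow (norm_nonneg _), ofReal_norm]
  simp

lemma IsTest.enorm_invFourier_pdOp_iterate {u : EuclideanSpace ℝ (Fin (m + 1)) → ℝ}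
    (hu : IsTest u) (i : Fin (m + 1)) (n : ℕ) :
    IsTest ((pdOp i)^[n] u) ∧ ∀ ξ, ‖invFourier ((pdOp i)^[n] u) ξ‖ₑ
      = ‖2 * Real.pi * ξ i‖ₑ ^ n * ‖invFourier u ξ‖ₑ := by
  induction n with
  | zero => exact ⟨hu, by simp⟩
  | succ n ih =>
    rw [Function.iterate_succ_apply']
    refine ⟨ih.1.isTest_pdOp i, fun ξ => ?_⟩
    rw [ih.1.enorm_invFourier_pdOp, ih.2, pow_succ]
    ring

lemma IsTest.enorm_invFourier_mderiv {u : EuclideanSpace ℝ (Fin (m + 1)) → ℝ}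
    (hu : IsTest u) (β : Fin (m + 1) → ℕ) (ξ : EuclideanSpace ℝ (Fin (m + 1))) :
    ‖invFourier (mderiv β u) ξ‖ₑ
      = (∏ i, ‖2 * Real.pi * ξ i‖ₑ ^ β i) * ‖invFourier u ξ‖ₑ := by
  have key : ∀ l : List (Fin (m + 1)),
      IsTest (l.foldr (fun i v => (pdOp i)^[β i] v) u) ∧
      ‖invFourier (l.foldr (fun i v => (pdOp i)^[β i] v) u) ξ‖ₑ
        = (l.map fun i => ‖2 * Real.pi * ξ i‖ₑ ^ β i).prod * ‖invFourier u ξ‖ₑ := by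
    intro l
    induction l with
    | nil => exact ⟨hu, by simp⟩
    | cons i l ih =>
      have h := ih.1.enorm_invFourier_pdOp_iterate i (β i)
      refine ⟨h.1, ?_⟩
      rw [List.foldr_cons, h.2, ih.2, List.map_cons, List.prod_cons]
      ring
  rw [mderiv, (key _).2, ← List.ofFn_eq_map, List.prod_ofFn]

/-- The energy `‖u‖² + Σ_i ‖ℓ_i^s ∂_i^s u‖²`. -/
def scaledEnergy (s : ℕ) (ℓ : Fin (m + 1) → ℝ) (u : EuclideanSpace ℝ (Fin (m + 1)) → ℝ) : ℝ≥0∞ :=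
  (∫⁻ x, ‖u x‖ₑ ^ 2) + ∑ i, ∫⁻ x, ‖ℓ i ^ s * (pdOp i)^[s] u x‖ₑ ^ 2

lemma measurable_scaledSymbol (ℓ : Fin (m + 1) → ℝ) : Measurable (scaledSymbol ℓ) := by
  unfold scaledSymbol
  fun_prop

lemma IsTest.lintegral_scaledSymbol_le {u : EuclideanSpace ℝ (Fin (m + 1)) → ℝ}
    (hu : IsTest u) (s : ℕ) (ℓ : Fin (m + 1) → ℝ) :
    ∫⁻ ξ, scaledSymbol ℓ ξ ^ s * ‖invFourier u ξ‖ₑ ^ 2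
      ≤ 2 ^ s * (m + 1 : ℝ≥0∞) ^ s * scaledEnergy s ℓ u := by
  have hm := hu.measurable_enorm_invFourier
  have hE : scaledEnergy s ℓ u = ∫⁻ ξ, (1 + ∑ i, (‖ℓ i * (2 * Real.pi * ξ i)‖ₑ ^ 2) ^ s)
      * ‖invFourier u ξ‖ₑ ^ 2 := by
    simp_rw [add_mul, Finset.sum_mul]
    rw [lintegral_add_left (by fun_prop), lintegral_finsetSum _ (fun i _ => by fun_prop),
      scaledEnergy]
    congr 1
    · simp [hu.lintegral_invFourier]
    · refine Finset.sum_congr rfl fun i _ => ?_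
      have h := hu.enorm_invFourier_pdOp_iterate i s
      simp_rw [enorm_mul, mul_pow]
      rw [lintegral_const_mul' _ _ (by finiteness), ← h.1.lintegral_invFourier,
        ← lintegral_const_mul' _ _ (by finiteness)]
      refine lintegral_congr fun ξ => ?_
      rw [h.2, enorm_pow]
      simp only [enorm_mul]
      ring
  rw [hE, ← lintegral_const_mul' _ _ (by finiteness)]
  refine lintegral_mono fun ξ => ?_
  rw [← mul_assoc]
  gcongr
  calc scaledSymbol ℓ ξ ^ s
      ≤ 2 ^ s * (1 ^ s + (∑ i, ‖ℓ i * (2 * Real.pi * ξ i)‖ₑ ^ 2) ^ s) :=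
        ENNReal.add_pow_le_two_pow_mul _ _ _
    _ ≤ 2 ^ s * ((m + 1 : ℝ≥0∞) ^ s * 1 + (m + 1 : ℝ≥0∞) ^ s
          * ∑ i, (‖ℓ i * (2 * Real.pi * ξ i)‖ₑ ^ 2) ^ s) := by
        gcongr
        · rw [one_pow, mul_one]
          exact one_le_pow₀ (by simp)
        · simpa using ENNReal.sum_pow_le_card_pow_mul
            (fun i => ‖ℓ i * (2 * Real.pi * ξ i)‖ₑ ^ 2) s
    _ = _ := by ring

/-- The algebra property of `H^s`, `s > d/2`, with explicit dependence on a rescaling of the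
coordinates. -/
lemma exists_scaled_sobolev_algebra {s : ℕ} (hs : ((m : ℝ) + 1) / 2 < s) :
    ∃ C : ℝ≥0∞, C ≠ ⊤ ∧ ∀ ℓ : Fin (m + 1) → ℝ, (∀ i, 0 < ℓ i) →
      ∀ u v : EuclideanSpace ℝ (Fin (m + 1)) → ℝ, IsTest u → IsTest v →
      ∀ β : Fin (m + 1) → ℕ, ∑ i, β i ≤ s →
        ∫⁻ x, ‖(∏ i, ℓ i ^ β i) * mderiv β (fun x => u x * v x) x‖ₑ ^ 2
          ≤ C * ENNReal.ofReal (∏ i, ℓ i)⁻¹ * scaledEnergy s ℓ u * scaledEnergy s ℓ v := by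
  set J := ∫⁻ ξ : EuclideanSpace ℝ (Fin (m + 1)), ((1 + ‖ξ‖ₑ ^ 2) ^ s)⁻¹ with hJ
  have hJt : J ≠ ⊤ := lintegral_inv_one_add_enorm_sq_pow_ne_top hs
  set B : ℝ≥0∞ := 2 ^ s * (m + 1 : ℝ≥0∞) ^ s with hB
  refine ⟨2 * (4 ^ s * 2 ^ s) * (ENNReal.ofReal (∏ _i : Fin (m + 1), (2 * Real.pi))⁻¹ * J) * B * B,
    by finiteness, fun ℓ hℓ u v hu hv β hβ => ?_⟩
  set M := scaledSymbol ℓ with hM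
  have hMm : Measurable M := measurable_scaledSymbol ℓ
  have h1M : ∀ ξ, 1 ≤ M ξ := fun ξ => le_self_add
  have hMt : ∀ ξ, M ξ ≠ ⊤ := fun ξ => by
    rw [hM, scaledSymbol]
    exact ENNReal.add_ne_top.2 ⟨by simp, ENNReal.sum_ne_top.2 fun i _ => by finiteness⟩
  have hMsub : ∀ ξ t, M ξ ≤ 4 * (M t + M (ξ - t)) := fun ξ t => by
    have : ∀ i, ‖ℓ i * (2 * Real.pi * ξ i)‖ₑ ^ 2 ≤ 4 * (‖ℓ i * (2 * Real.pi * t i)‖ₑ ^ 2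
        + ‖ℓ i * (2 * Real.pi * (ξ - t) i)‖ₑ ^ 2) := fun i => by
      have h : ℓ i * (2 * Real.pi * ξ i) = ℓ i * (2 * Real.pi * t i)
          + ℓ i * (2 * Real.pi * (ξ - t) i) := by
        simp only [PiLp.sub_apply]; ring
      rw [h, show (4 : ℝ≥0∞) = 2 ^ 2 by norm_num]
      exact le_trans (by gcongr; exact enorm_add_le _ _) (ENNReal.add_pow_le_two_pow_mul _ _ 2)
    calc M ξ ≤ 4 * (1 + 1) + ∑ i, 4 * (‖ℓ i * (2 * Real.pi * t i)‖ₑ ^ 2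
        + ‖ℓ i * (2 * Real.pi * (ξ - t) i)‖ₑ ^ 2) := by
          rw [hM, scaledSymbol]
          gcongr with i
          · norm_num
          · exact this i
      _ = 4 * (M t + M (ξ - t)) := by
          rw [← Finset.mul_sum, Finset.sum_add_distrib, hM, scaledSymbol, scaledSymbol]
          ring
  have hconv := lintegral_weight_mul_conv_sq_le (P := fun ξ => M ξ ^ s) (A := 4 ^ s * 2 ^ s)
    (hMm.pow_const s) hu.measurable_enorm_invFourier hv.measurable_enorm_invFourier
    (fun ξ => pow_ne_zero _ (one_pos.trans_le (h1M ξ)).ne') (fun ξ => ENNReal.pow_ne_top (hMt ξ))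
    (fun ξ t => by
      calc M ξ ^ s ≤ (4 * (M t + M (ξ - t))) ^ s := by gcongr; exact hMsub ξ t
        _ ≤ 4 ^ s * (2 ^ s * (M t ^ s + M (ξ - t) ^ s)) := by
          rw [mul_pow]; gcongr; exact ENNReal.add_pow_le_two_pow_mul _ _ _
        _ = _ := by ring)
  have huv := hu.mul hv
  have hprod : ‖∏ i, ℓ i ^ β i‖ₑ = ∏ i, ‖ℓ i‖ₑ ^ β i := by
    simp [enorm_eq_nnnorm, nnnorm_prod]
  calc ∫⁻ x, ‖(∏ i, ℓ i ^ β i) * mderiv β (fun x => u x * v x) x‖ₑ ^ 2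
      = ∫⁻ ξ, (∏ i, (‖ℓ i * (2 * Real.pi * ξ i)‖ₑ ^ 2) ^ β i)
          * ‖invFourier (fun x => u x * v x) ξ‖ₑ ^ 2 := by
        simp_rw [enorm_mul, mul_pow]
        rw [lintegral_const_mul' _ _ (by finiteness),
          ← (huv.isTest_mderiv β).lintegral_invFourier, ← lintegral_const_mul' _ _ (by finiteness)]
        refine lintegral_congr fun ξ => ?_
        rw [huv.enorm_invFourier_mderiv, mul_pow, ← mul_assoc, hprod, ← mul_pow,
          ← Finset.prod_mul_distrib, ← Finset.prod_pow]
        congr 1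
        refine Finset.prod_congr rfl fun i _ => ?_
        simp only [enorm_mul]
        ring
    _ ≤ ∫⁻ ξ, M ξ ^ s * (∫⁻ t, ‖invFourier u t‖ₑ * ‖invFourier v (ξ - t)‖ₑ) ^ 2 := by
        refine lintegral_mono fun ξ => ?_
        gcongr ?_ * ?_ ^ 2
        · calc ∏ i, (‖ℓ i * (2 * Real.pi * ξ i)‖ₑ ^ 2) ^ β i ≤ ∏ i, M ξ ^ β i := by
                refine Finset.prod_le_prod' fun i _ => ?_
                gcongr
                exact (Finset.single_le_sum (f := fun i => ‖ℓ i * (2 * Real.pi * ξ i)‖ₑ ^ 2)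
                  (fun _ _ => zero_le) (Finset.mem_univ i)).trans le_add_self
            _ = M ξ ^ ∑ i, β i := Finset.prod_pow_eq_pow_sum _ _ _
            _ ≤ M ξ ^ s := pow_le_pow_right₀ (h1M ξ) hβ
        · exact hu.enorm_invFourier_mul_le hv ξ
    _ ≤ _ := hconv
    _ ≤ 2 * (4 ^ s * 2 ^ s) * (ENNReal.ofReal (∏ i, (ℓ i * (2 * Real.pi)))⁻¹ * J)
          * (B * scaledEnergy s ℓ u) * (B * scaledEnergy s ℓ v) := by
        rw [hM, lintegral_inv_scaledSymbol_pow ℓ hℓ s]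
        gcongr
        · exact hu.lintegral_scaledSymbol_le s ℓ
        · exact hv.lintegral_scaledSymbol_le s ℓ
    _ = _ := by
        rw [Finset.prod_mul_distrib, mul_inv, ENNReal.ofReal_mul
          (inv_nonneg.2 (Finset.prod_nonneg fun i _ => (hℓ i).le))]
        ring

lemma iteratedDeriv_line {u : EuclideanSpace ℝ (Fin (m + 1)) → ℝ} (hu : ContDiff ℝ ∞ u)
    (i : Fin (m + 1)) (x : EuclideanSpace ℝ (Fin (m + 1))) (n : ℕ) :
    iteratedDeriv n (fun t : ℝ => u (x + t • EuclideanSpace.single i 1))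
      = fun t => (pdOp i)^[n] u (x + t • EuclideanSpace.single i 1) := by
  induction n with
  | zero => simp
  | succ n ih =>
    rw [iteratedDeriv_succ, ih]
    ext t
    rw [Function.iterate_succ_apply']
    have h1 := (((contDiff_pdOp_iterate hu i n).differentiable (by simp))
      (x + t • EuclideanSpace.single i 1)).hasFDerivAt
    have h2 : HasDerivAt (fun t : ℝ => x + t • EuclideanSpace.single i (1 : ℝ))
        (EuclideanSpace.single i 1) t := by
      simpa using ((hasDerivAt_id t).smul_const (EuclideanSpace.single i (1 : ℝ))).const_add x
    exact (h1.comp_hasDerivAt t h2).deriv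

lemma pdOp_iterate_eq_iteratedDeriv {u : EuclideanSpace ℝ (Fin (m + 1)) → ℝ}
    (hu : ContDiff ℝ ∞ u) (i : Fin (m + 1)) (x : EuclideanSpace ℝ (Fin (m + 1))) (n : ℕ) :
    (pdOp i)^[n] u x = iteratedDeriv n (fun t : ℝ => u (x + t • EuclideanSpace.single i 1)) 0 := by
  simp [iteratedDeriv_line hu]

/-- A bump function equal to `1` on `[1/2, 5/2]` and supported in `[1/4, 11/4]`. -/
def shellBump : ContDiffBump (3 / 2 : ℝ) where
  rIn := 1
  rOut := 5 / 4
  rIn_pos := one_pos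
  rIn_lt_rOut := by norm_num

lemma exists_iteratedDeriv_shellBump_bound (s : ℕ) :
    ∃ B : ℝ, ∀ k ≤ s, ∀ t, |iteratedDeriv k shellBump t| ≤ B := by
  have h : ∀ k : ℕ, ∃ B : ℝ, ∀ t, |iteratedDeriv k shellBump t| ≤ B := fun k => by
    have hc : Continuous (iteratedFDeriv ℝ k shellBump) :=
      (shellBump.contDiff (n := k)).continuous_iteratedFDeriv le_rfl
    obtain ⟨B, hB⟩ := hc.bounded_above_of_compact_support
      (shellBump.hasCompactSupport.iteratedFDeriv k)
    refine ⟨B, fun t => ?_⟩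
    rw [← Real.norm_eq_abs, ← norm_iteratedFDeriv_eq_norm_iteratedDeriv]
    exact hB t
  choose B hB using h
  refine ⟨∑ k ∈ Finset.range (s + 1), |B k|, fun k hk t => ?_⟩
  exact (hB k t).trans ((le_abs_self _).trans (Finset.single_le_sum (f := fun k => |B k|)
    (fun _ _ => abs_nonneg _) (Finset.mem_range.2 (by omega))))

/-- Localisation of `u` to the shell `x_d ∼ r`. -/
def shellCut (r : ℝ) (u : EuclideanSpace ℝ (Fin (m + 1)) → ℝ) :
    EuclideanSpace ℝ (Fin (m + 1)) → ℝ :=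
  fun x => shellBump (r⁻¹ * x (Fin.last m)) * u x

/-- The enlarged shell carrying `shellCut r u`. -/
def fatShell (m : ℕ) (r : ℝ) : Set (EuclideanSpace ℝ (Fin (m + 1))) :=
  {x | r / 4 ≤ x (Fin.last m) ∧ x (Fin.last m) ≤ 11 / 4 * r}

lemma isClosed_fatShell (r : ℝ) : IsClosed (fatShell m r) := by
  have h : Continuous fun x : EuclideanSpace ℝ (Fin (m + 1)) => x (Fin.last m) := by fun_prop
  exact (isClosed_le continuous_const h).inter (isClosed_le h continuous_const)

lemma contDiff_shellBump_coord (r : ℝ) :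
    ContDiff ℝ ∞ fun x : EuclideanSpace ℝ (Fin (m + 1)) =>
      shellBump (r⁻¹ * x (Fin.last m)) :=
  shellBump.contDiff.comp (by fun_prop)

lemma IsTest.shellCut {u : EuclideanSpace ℝ (Fin (m + 1)) → ℝ} (hu : IsTest u) (r : ℝ) :
    IsTest (shellCut r u) :=
  ⟨(contDiff_shellBump_coord r).mul hu.1, hu.2.mul_left⟩

lemma tsupport_shellCut_subset {r : ℝ} (hr : 0 < r) (u : EuclideanSpace ℝ (Fin (m + 1)) → ℝ) :
    tsupport (shellCut r u) ⊆ fatShell m r := by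
  refine closure_minimal (fun x hx => ?_) (isClosed_fatShell r)
  have h1 : shellBump (r⁻¹ * x (Fin.last m)) ≠ 0 := left_ne_zero_of_mul hx
  have h2 : r⁻¹ * x (Fin.last m) ∈ Metric.ball (3 / 2 : ℝ) (5 / 4) := by
    have := shellBump.support_eq ▸ (Function.mem_support.2 h1)
    exact this
  rw [Metric.mem_ball, Real.dist_eq, abs_lt] at h2
  have h3 : x (Fin.last m) = r * (r⁻¹ * x (Fin.last m)) := by field_simp
  constructor <;> rw [h3] <;> nlinarith

/-- Anisotropic length scales at height `r`: `r^α` in the `x'` directions, `r` in `x_d`. -/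
def anisoScale (m : ℕ) (α r : ℝ) (i : Fin (m + 1)) : ℝ :=
  if i = Fin.last m then r else r ^ α

lemma anisoScale_pos (α : ℝ) {r : ℝ} (hr : 0 < r) (i : Fin (m + 1)) : 0 < anisoScale m α r i := by
  unfold anisoScale
  split_ifs <;> positivity

lemma prod_anisoScale_pow (α : ℝ) {r : ℝ} (hr : 0 < r) (β : Fin (m + 1) → ℕ) :
    ∏ i, anisoScale m α r i ^ β i = r ^ aweight m α 0 β := by
  rw [Fin.prod_univ_castSucc]
  simp only [anisoScale, Fin.castSucc_ne_last, if_true, if_false, aweight]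
  rw [Finset.prod_pow_eq_pow_sum, add_zero, Real.rpow_add hr, Real.rpow_natCast, mul_comm _ α,
    Real.rpow_mul_natCast hr.le]

lemma prod_anisoScale (α : ℝ) {r : ℝ} (hr : 0 < r) :
    ∏ i, anisoScale m α r i = r ^ ((m : ℝ) * α + 1) := by
  have h := prod_anisoScale_pow (m := m) α hr (fun _ => 1)
  simpa [aweight] using h

lemma aweight_add (α δ : ℝ) (β : Fin (m + 1) → ℕ) :
    aweight m α δ β = aweight m α 0 β + δ := by
  simp [aweight]

lemma mderiv_single (i : Fin (m + 1)) (k : ℕ) (u : EuclideanSpace ℝ (Fin (m + 1)) → ℝ) :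
    mderiv (Pi.single i k) u = (pdOp i)^[k] u := by
  have key : ∀ l : List (Fin (m + 1)), l.Nodup →
      l.foldr (fun j v => (pdOp j)^[(Pi.single i k : Fin (m + 1) → ℕ) j] v) u
        = if i ∈ l then (pdOp i)^[k] u else u := by
    intro l hl
    induction l with
    | nil => simp
    | cons j l ih =>
      rw [List.foldr_cons, ih hl.of_cons]
      by_cases hij : j = i
      · subst hij
        simp [(List.nodup_cons.1 hl).1]
      · simp [hij, Ne.symm hij]
  rw [mderiv, key _ (List.nodup_finRange _), if_pos (List.mem_finRange i)]

/-- Leibniz expansion of the scaled derivatives of a localised function. -/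
lemma pdOp_iterate_shellCut {u : EuclideanSpace ℝ (Fin (m + 1)) → ℝ} (hu : ContDiff ℝ ∞ u)
    {r : ℝ} (hr : 0 < r) (α : ℝ) (i : Fin (m + 1)) (n : ℕ)
    (x : EuclideanSpace ℝ (Fin (m + 1))) :
    ∃ ε : ℝ, |ε| ≤ 1 ∧ anisoScale m α r i ^ n * (pdOp i)^[n] (shellCut r u) x
      = ∑ k ∈ Finset.range (n + 1), (n.choose k * ε ^ k
          * iteratedDeriv k shellBump (r⁻¹ * x (Fin.last m)))
          * (anisoScale m α r i ^ (n - k) * (pdOp i)^[n - k] u x) := by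
  set c : ℝ := if i = Fin.last m then r⁻¹ else 0 with hc
  refine ⟨anisoScale m α r i * c, ?_, ?_⟩
  · rw [hc, anisoScale]
    split_ifs
    · simp [hr.ne']
    · simp
  have hF : ContDiff ℝ ∞ (shellCut r u) := (contDiff_shellBump_coord r).mul hu
  have hline : ContDiff ℝ ∞ fun t : ℝ => u (x + t • EuclideanSpace.single i 1) :=
    hu.comp (by fun_prop)
  have hb : ContDiff ℝ ∞ shellBump := shellBump.contDiff
  have hcoord : ∀ t : ℝ, r⁻¹ * (x + t • EuclideanSpace.single i (1 : ℝ)) (Fin.last m)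
      = r⁻¹ * x (Fin.last m) + c * t := fun t => by
    by_cases hi : i = Fin.last m
    · simp [hc, hi]; ring
    · simp [hc, hi, Ne.symm hi]
  have hbump : ∀ k, iteratedDeriv k (fun t => shellBump (r⁻¹ * x (Fin.last m) + c * t)) 0
      = c ^ k * iteratedDeriv k shellBump (r⁻¹ * x (Fin.last m)) := fun k => by
    have h1 : ContDiff ℝ k fun t => shellBump (r⁻¹ * x (Fin.last m) + t) :=
      shellBump.contDiff.comp (by fun_prop)
    have h2 := congrFun (iteratedDeriv_comp_const_mul h1 c) 0
    rw [h2, iteratedDeriv_comp_const_add]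
    simp
  rw [pdOp_iterate_eq_iteratedDeriv hF]
  simp only [shellCut, hcoord]
  rw [iteratedDeriv_fun_mul]
  rotate_left
  · exact ((shellBump.contDiff (n := n)).comp (by fun_prop)).contDiffAt
  · exact (hline.of_le (by exact_mod_cast le_top)).contDiffAt
  rw [Finset.mul_sum]
  refine Finset.sum_congr rfl fun k hk => ?_
  rw [hbump, ← pdOp_iterate_eq_iteratedDeriv hu, mul_pow]
  have hk' : k + (n - k) = n := by have := Finset.mem_range.1 hk; omega
  conv_lhs => rw [← hk', pow_add, hk']
  ring

/-- Integrand of the square of `anisoNorm`. -/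
def sobolevDensity (s : ℕ) (α δ : ℝ) (u : EuclideanSpace ℝ (Fin (m + 1)) → ℝ)
    (x : EuclideanSpace ℝ (Fin (m + 1))) : ℝ :=
  ∑ β : Fin (m + 1) → Fin (s + 1), if (∑ i, ((β i : ℕ))) ≤ s then
    (jap x ^ aweight m α δ (fun i => (β i : ℕ)) * mderiv (fun i => (β i : ℕ)) u x) ^ 2 else 0

lemma jap_pos {d : ℕ} (x : EuclideanSpace ℝ (Fin d)) : 0 < jap x :=
  Real.sqrt_pos.2 (by positivity)

lemma continuous_jap_rpow {d : ℕ} (a : ℝ) :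
    Continuous fun x : EuclideanSpace ℝ (Fin d) => jap x ^ a :=
  (show Continuous (jap (d := d)) by unfold jap; fun_prop).rpow_const
    fun x => Or.inl (jap_pos x).ne'

lemma sobolevDensity_nonneg (s : ℕ) (α δ : ℝ) (u : EuclideanSpace ℝ (Fin (m + 1)) → ℝ)
    (x : EuclideanSpace ℝ (Fin (m + 1))) : 0 ≤ sobolevDensity s α δ u x :=
  Finset.sum_nonneg fun β _ => by split_ifs <;> positivity

lemma sq_le_sobolevDensity {s : ℕ} (α δ : ℝ) (u : EuclideanSpace ℝ (Fin (m + 1)) → ℝ)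
    (x : EuclideanSpace ℝ (Fin (m + 1))) {γ : Fin (m + 1) → ℕ} (hγ : ∑ i, γ i ≤ s) :
    (jap x ^ aweight m α δ γ * mderiv γ u x) ^ 2 ≤ sobolevDensity s α δ u x := by
  have hlt : ∀ i, γ i < s + 1 := fun i =>
    Nat.lt_succ_of_le ((Finset.single_le_sum (fun _ _ => Nat.zero_le _) (Finset.mem_univ i)).trans hγ)
  have h := Finset.single_le_sum (s := Finset.univ)
    (f := fun β : Fin (m + 1) → Fin (s + 1) => if (∑ i, ((β i : ℕ))) ≤ s then
      (jap x ^ aweight m α δ (fun i => (β i : ℕ)) * mderiv (fun i => (β i : ℕ)) u x) ^ 2 else 0)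
    (fun β _ => by split_ifs <;> positivity)
    (Finset.mem_univ fun i => (⟨γ i, hlt i⟩ : Fin (s + 1)))
  simp only [hγ, if_true] at h
  exact h

lemma IsTest.integrable_weighted_sq {u : EuclideanSpace ℝ (Fin (m + 1)) → ℝ} (hu : IsTest u) (a : ℝ)
    (β : Fin (m + 1) → ℕ) :
    Integrable (fun x => (jap x ^ a * mderiv β u x) ^ 2) := by
  have hc : Continuous fun x => (jap x ^ a * mderiv β u x) ^ 2 :=
    ((continuous_jap_rpow a).mul (hu.isTest_mderiv β).1.continuous).pow 2
  refine hc.integrable_of_hasCompactSupport ?_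
  simp only [pow_two, mul_assoc]
  exact HasCompactSupport.mul_left ((hu.isTest_mderiv β).2.mul_right)

lemma IsTest.integral_sobolevDensity {u : EuclideanSpace ℝ (Fin (m + 1)) → ℝ} (hu : IsTest u)
    (s : ℕ) (α δ : ℝ) : ∫ x, sobolevDensity s α δ u x = anisoNorm m s α δ u ^ 2 := by
  rw [anisoNorm, Real.sq_sqrt]
  · unfold sobolevDensity
    rw [integral_finsetSum]
    · refine Finset.sum_congr rfl fun β _ => ?_
      split_ifs <;> simp
    · intro β _
      split_ifs
      · exact hu.integrable_weighted_sq _ _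
      · simp
  · refine Finset.sum_nonneg fun β _ => ?_
    split_ifs
    · exact integral_nonneg fun x => sq_nonneg _
    · exact le_rfl

lemma IsTest.lintegral_sobolevDensity {u : EuclideanSpace ℝ (Fin (m + 1)) → ℝ} (hu : IsTest u)
    (s : ℕ) (α δ : ℝ) :
    ∫⁻ x, ENNReal.ofReal (sobolevDensity s α δ u x) = ENNReal.ofReal (anisoNorm m s α δ u ^ 2) := by
  rw [← hu.integral_sobolevDensity, ofReal_integral_eq_lintegral_ofReal]
  · refine integrable_finsetSum _ fun β _ => ?_
    split_ifs
    · exact hu.integrable_weighted_sq _ _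
    · simp
  · exact .of_forall fun x => sobolevDensity_nonneg ..

lemma le_jap_of_mem_degSector {α : ℝ} (hα1 : α ≤ 1) {x : EuclideanSpace ℝ (Fin (m + 1))}
    (hx : x ∈ degSector m α) : x (Fin.last m) ≤ jap x ∧ jap x ≤ 2 * x (Fin.last m) := by
  obtain ⟨h1, h2⟩ := hx
  have hnorm : ‖x‖ ^ 2 = ∑ i : Fin m, x i.castSucc ^ 2 + x (Fin.last m) ^ 2 := by
    rw [EuclideanSpace.norm_sq_eq, Fin.sum_univ_castSucc]
    simp
  have h3 : x (Fin.last m) ^ α ≤ x (Fin.last m) := by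
    simpa using Real.rpow_le_rpow_of_exponent_le h2 hα1
  have h0 : 0 ≤ ∑ i : Fin m, x i.castSucc ^ 2 := Finset.sum_nonneg fun _ _ => sq_nonneg _
  have h4 : ∑ i : Fin m, x i.castSucc ^ 2 ≤ x (Fin.last m) ^ 2 :=
    (Real.sqrt_le_left (by linarith)).1 (h1.trans h3)
  unfold jap
  rw [hnorm]
  constructor
  · exact Real.le_sqrt_of_sq_le (by linarith)
  · exact (Real.sqrt_le_left (by linarith)).2 (by nlinarith)

lemma rpow_le_of_comparable {x y : ℝ} (hx : 0 < x) (hy : 0 < y) (hxy : x ≤ 6 * y)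
    (hyx : y ≤ 6 * x) (a : ℝ) : x ^ a ≤ 6 ^ |a| * y ^ a := by
  rcases le_total 0 a with ha | ha
  · rw [abs_of_nonneg ha, ← Real.mul_rpow (by norm_num) hy.le]
    exact Real.rpow_le_rpow hx.le hxy ha
  · rw [abs_of_nonpos ha, Real.rpow_neg (by norm_num), ← Real.inv_rpow (by norm_num),
      ← Real.mul_rpow (by norm_num) hy.le]
    exact Real.rpow_le_rpow_of_nonpos (by positivity) (by linarith) ha

lemma abs_aweight_le {s : ℕ} {α : ℝ} (hα0 : 0 < α) (hα1 : α ≤ 1) (δ : ℝ)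
    {γ : Fin (m + 1) → ℕ} (hγ : ∑ i, γ i ≤ s) : |aweight m α δ γ| ≤ s + |δ| := by
  rw [Fin.sum_univ_castSucc] at hγ
  have hγ' : ((∑ i : Fin m, γ i.castSucc : ℕ) : ℝ) + (γ (Fin.last m) : ℝ) ≤ s := by
    exact_mod_cast hγ
  have h1 : (0 : ℝ) ≤ ((∑ i : Fin m, γ i.castSucc : ℕ) : ℝ) := Nat.cast_nonneg _
  have h2 : (0 : ℝ) ≤ (γ (Fin.last m) : ℝ) := Nat.cast_nonneg _
  unfold aweight
  refine (abs_add_le _ _).trans (add_le_add ?_ le_rfl)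
  rw [abs_of_nonneg (by positivity)]
  nlinarith

/-- On the fat shell at height `r` inside the sector, `⟨x⟩` and `r` are interchangeable as weights. -/
lemma weight_comparable {s : ℕ} {α : ℝ} (hα0 : 0 < α) (hα1 : α ≤ 1) (δ : ℝ) {r : ℝ} (hr : 0 < r)
    {x : EuclideanSpace ℝ (Fin (m + 1))} (hx : x ∈ fatShell m r) (hΩ : x ∈ degSector m α)
    {γ : Fin (m + 1) → ℕ} (hγ : ∑ i, γ i ≤ s) :
    r ^ aweight m α δ γ ≤ 6 ^ (s + |δ|) * jap x ^ aweight m α δ γ ∧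
      jap x ^ aweight m α δ γ ≤ 6 ^ (s + |δ|) * r ^ aweight m α δ γ := by
  obtain ⟨h1, h2⟩ := le_jap_of_mem_degSector hα1 hΩ
  obtain ⟨h3, h4⟩ := hx
  have hj := jap_pos x
  have h6 : (6 : ℝ) ^ |aweight m α δ γ| ≤ 6 ^ (s + |δ|) :=
    Real.rpow_le_rpow_of_exponent_le (by norm_num) (abs_aweight_le hα0 hα1 δ hγ)
  constructor
  · exact (rpow_le_of_comparable hr hj (by linarith) (by linarith) _).trans (by gcongr)
  · exact (rpow_le_of_comparable hj hr (by linarith) (by linarith) _).trans (by gcongr)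

lemma mderiv_eq_zero_of_notMem {u : EuclideanSpace ℝ (Fin (m + 1)) → ℝ}
    {A : Set (EuclideanSpace ℝ (Fin (m + 1)))} (hA : tsupport u ⊆ A)
    {x : EuclideanSpace ℝ (Fin (m + 1))} (hx : x ∉ A) (γ : Fin (m + 1) → ℕ) :
    mderiv γ u x = 0 :=
  image_eq_zero_of_notMem_tsupport fun h => hx (hA (tsupport_mderiv_subset γ u h))

lemma sq_rpow_mul_mderiv_le {s : ℕ} {α : ℝ} (hα0 : 0 < α) (hα1 : α ≤ 1) (δ : ℝ) {r : ℝ}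
    (hr : 0 < r) {u : EuclideanSpace ℝ (Fin (m + 1)) → ℝ} (hΩ : tsupport u ⊆ degSector m α)
    {x : EuclideanSpace ℝ (Fin (m + 1))} (hx : x ∈ fatShell m r)
    {γ : Fin (m + 1) → ℕ} (hγ : ∑ i, γ i ≤ s) :
    (r ^ aweight m α δ γ * mderiv γ u x) ^ 2
      ≤ (6 ^ (s + |δ|)) ^ 2 * sobolevDensity s α δ u x := by
  have hD := sobolevDensity_nonneg s α δ u x
  by_cases hxΩ : x ∈ degSector m α
  · refine le_trans ?_ (mul_le_mul_of_nonneg_left (sq_le_sobolevDensity α δ u x hγ) (by positivity))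
    rw [← mul_pow, ← mul_assoc, mul_pow, mul_pow _ (mderiv γ u x)]
    have := (weight_comparable hα0 hα1 δ hr hx hxΩ hγ).1
    gcongr
  · rw [mderiv_eq_zero_of_notMem hΩ hxΩ]
    simp only [mul_zero, ne_eq, OfNat.ofNat_ne_zero, not_false_eq_true, zero_pow]
    positivity

lemma sq_pdOp_iterate_shellCut_le {s : ℕ} {α : ℝ} (hα0 : 0 < α) (hα1 : α ≤ 1) (δ : ℝ) {B : ℝ}
    (hB : ∀ k ≤ s, ∀ t, |iteratedDeriv k shellBump t| ≤ B) {r : ℝ} (hr : 0 < r)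
    {u : EuclideanSpace ℝ (Fin (m + 1)) → ℝ} (hu : IsTest u) (hΩ : tsupport u ⊆ degSector m α)
    {x : EuclideanSpace ℝ (Fin (m + 1))} (hx : x ∈ fatShell m r) (i : Fin (m + 1)) {n : ℕ}
    (hn : n ≤ s) :
    (r ^ δ * (anisoScale m α r i ^ n * (pdOp i)^[n] (shellCut r u) x)) ^ 2
      ≤ (2 ^ s * B * 6 ^ (s + |δ|)) ^ 2 * sobolevDensity s α δ u x := by
  have hD := sobolevDensity_nonneg s α δ u x
  have hB0 : 0 ≤ B := (abs_nonneg _).trans (hB 0 (Nat.zero_le _) 0)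
  set X : ℝ := 6 ^ (s + |δ|) * √(sobolevDensity s α δ u x) with hX
  have hX0 : 0 ≤ X := by positivity
  have hterm : ∀ j ≤ s, |r ^ δ * (anisoScale m α r i ^ j * (pdOp i)^[j] u x)| ≤ X := by
    intro j hj
    have h := sq_rpow_mul_mderiv_le (γ := Pi.single i j) (s := s) hα0 hα1 δ hr hΩ hx (by simpa)
    refine abs_le_of_sq_le_sq ?_ hX0
    rw [hX, mul_pow _ (√_), Real.sq_sqrt hD]
    refine le_of_eq_of_le ?_ h
    rw [mderiv_single, aweight_add, Real.rpow_add hr, ← prod_anisoScale_pow α hr,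
      Fintype.prod_eq_single i (fun j hj => by simp [hj]), Pi.single_eq_same]
    ring
  obtain ⟨ε, hε, hsum⟩ := pdOp_iterate_shellCut hu.1 hr α i n x
  have hmain : |r ^ δ * (anisoScale m α r i ^ n * (pdOp i)^[n] (shellCut r u) x)|
      ≤ 2 ^ s * B * X := by
    rw [hsum, Finset.mul_sum]
    calc _ ≤ ∑ k ∈ Finset.range (n + 1), (n.choose k : ℝ) * (B * X) := by
          refine (Finset.abs_sum_le_sum_abs _ _).trans (Finset.sum_le_sum fun k hk => ?_)
          have hkn : k ≤ n := by have := Finset.mem_range.1 hk; omega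
          rw [mul_left_comm, abs_mul, abs_mul, abs_mul, Nat.abs_cast, abs_pow, mul_assoc, mul_assoc]
          have h1 := hterm (n - k) (by omega)
          have h2 := hB k (hkn.trans hn) (r⁻¹ * x (Fin.last m))
          have h3 : |ε| ^ k ≤ 1 := pow_le_one₀ (abs_nonneg _) hε
          calc _ ≤ (n.choose k : ℝ) * (1 * (B * X)) := by gcongr
            _ = _ := by ring
      _ = 2 ^ n * (B * X) := by
          rw [← Finset.sum_mul, ← Nat.cast_sum, Nat.sum_range_choose]; norm_num
      _ ≤ 2 ^ s * (B * X) := by gcongr; norm_num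
      _ = _ := by ring
  rw [← sq_abs]
  refine (pow_le_pow_left₀ (abs_nonneg _) hmain 2).trans_eq ?_
  rw [hX, ← mul_assoc, mul_pow _ (√_), Real.sq_sqrt hD]

lemma enorm_sq_eq_ofReal (y : ℝ) : ‖y‖ₑ ^ 2 = ENNReal.ofReal (y ^ 2) := by
  rw [Real.enorm_eq_ofReal_abs, ← ENNReal.ofReal_pow (abs_nonneg _), sq_abs]

/-- The scaled energy of a localised function is controlled by the density on the fat shell. -/
lemma scaledEnergy_shellCut_le {s : ℕ} {α : ℝ} (hα0 : 0 < α) (hα1 : α ≤ 1) (δ : ℝ) {B : ℝ}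
    (hB : ∀ k ≤ s, ∀ t, |iteratedDeriv k shellBump t| ≤ B) {r : ℝ} (hr : 0 < r)
    {u : EuclideanSpace ℝ (Fin (m + 1)) → ℝ} (hu : IsTest u)
    (hΩ : tsupport u ⊆ degSector m α) :
    ‖r ^ δ‖ₑ ^ 2 * scaledEnergy s (anisoScale m α r) (shellCut r u)
      ≤ (m + 2) * ENNReal.ofReal ((2 ^ s * B * 6 ^ (s + |δ|)) ^ 2)
        * ∫⁻ x in fatShell m r, ENNReal.ofReal (sobolevDensity s α δ u x) := by
  set K := ENNReal.ofReal ((2 ^ s * B * 6 ^ (s + |δ|)) ^ 2)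
  have hpt : ∀ i, ∀ n ≤ s,
      ‖r ^ δ‖ₑ ^ 2 * ∫⁻ x, ‖anisoScale m α r i ^ n * (pdOp i)^[n] (shellCut r u) x‖ₑ ^ 2
        ≤ K * ∫⁻ x in fatShell m r, ENNReal.ofReal (sobolevDensity s α δ u x) := by
    intro i n hn
    rw [← lintegral_const_mul' _ _ (by finiteness), ← lintegral_const_mul' _ _ (by finiteness),
      ← lintegral_indicator (isClosed_fatShell r).measurableSet]
    refine lintegral_mono fun x => ?_
    rw [← mul_pow, ← enorm_mul]
    by_cases hx : x ∈ fatShell m r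
    · rw [Set.indicator_of_mem hx, enorm_sq_eq_ofReal, ← ENNReal.ofReal_mul (by positivity)]
      exact ENNReal.ofReal_le_ofReal
        (sq_pdOp_iterate_shellCut_le hα0 hα1 δ hB hr hu hΩ hx i hn)
    · have h0 := mderiv_eq_zero_of_notMem (tsupport_shellCut_subset hr u) hx (Pi.single i n)
      rw [mderiv_single] at h0
      simp [h0]
  unfold scaledEnergy
  rw [mul_add, Finset.mul_sum]
  have h0 := hpt 0 0 (Nat.zero_le _)
  simp only [pow_zero, one_mul, Function.iterate_zero, id_eq] at h0
  refine (add_le_add h0 (Finset.sum_le_sum fun i _ => hpt i s le_rfl)).trans_eq ?_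
  rw [Finset.sum_const, Finset.card_univ, Fintype.card_fin, nsmul_eq_mul]
  push_cast
  ring

lemma mderiv_congr_of_eventuallyEq {u v : EuclideanSpace ℝ (Fin (m + 1)) → ℝ}
    {x : EuclideanSpace ℝ (Fin (m + 1))} (h : u =ᶠ[nhds x] v) (β : Fin (m + 1) → ℕ) :
    mderiv β u =ᶠ[nhds x] mderiv β v := by
  unfold mderiv
  induction List.finRange (m + 1) with
  | nil => exact h
  | cons i l ih =>
    rw [List.foldr_cons, List.foldr_cons]
    induction β i with
    | zero => exact ih
    | succ n ihn =>
      rw [Function.iterate_succ_apply', Function.iterate_succ_apply']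
      filter_upwards [ihn.fderiv (𝕜 := ℝ)] with y hy
      simp only [pdOp, hy]

/-- The half-open shell `r ≤ x_d < 2r`. -/
def shell (m : ℕ) (r : ℝ) : Set (EuclideanSpace ℝ (Fin (m + 1))) :=
  {x | r ≤ x (Fin.last m) ∧ x (Fin.last m) < 2 * r}

lemma measurableSet_shell (r : ℝ) : MeasurableSet (shell m r) := by
  have h : Measurable fun x : EuclideanSpace ℝ (Fin (m + 1)) => x (Fin.last m) :=
    (show Continuous fun x : EuclideanSpace ℝ (Fin (m + 1)) => x (Fin.last m) by
      fun_prop).measurable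
  exact (measurableSet_le measurable_const h).inter (measurableSet_lt h measurable_const)

lemma shell_subset_fatShell {r : ℝ} (hr : 0 < r) : shell m r ⊆ fatShell m r :=
  fun _ hx => ⟨by linarith [hx.1], by linarith [hx.2]⟩

lemma shellCut_eventuallyEq {r : ℝ} (hr : 0 < r) (u : EuclideanSpace ℝ (Fin (m + 1)) → ℝ)
    {x : EuclideanSpace ℝ (Fin (m + 1))} (hx : x ∈ shell m r) :
    shellCut r u =ᶠ[nhds x] u := by
  have hc : Continuous fun y : EuclideanSpace ℝ (Fin (m + 1)) => r⁻¹ * y (Fin.last m) := by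
    fun_prop
  have hmem : r⁻¹ * x (Fin.last m) ∈ Metric.ball (3 / 2 : ℝ) 1 := by
    have h3 : x (Fin.last m) = r * (r⁻¹ * x (Fin.last m)) := by field_simp
    obtain ⟨h1, h2⟩ := hx
    rw [h3] at h1 h2
    rw [Metric.mem_ball, Real.dist_eq, abs_lt]
    constructor <;> nlinarith
  filter_upwards [hc.continuousAt.preimage_mem_nhds (Metric.isOpen_ball.mem_nhds hmem)] with y hy
  rw [shellCut, shellBump.one_of_mem_closedBall (Metric.ball_subset_closedBall hy), one_mul]

/-- The bilinear estimate on a single shell. -/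
lemma exists_shell_estimate {s : ℕ} (hs : ((m : ℝ) + 1) / 2 < s) {α : ℝ} (hα0 : 0 < α)
    (hα1 : α ≤ 1) (δ₁ δ₂ : ℝ) :
    ∃ C : ℝ≥0∞, C ≠ ⊤ ∧ ∀ r : ℝ, 0 < r → ∀ g h : EuclideanSpace ℝ (Fin (m + 1)) → ℝ,
      IsTest g → tsupport g ⊆ degSector m α → IsTest h → tsupport h ⊆ degSector m α →
      ∀ β : Fin (m + 1) → ℕ, ∑ i, β i ≤ s →
      ∫⁻ x in shell m r, ‖jap x ^ aweight m α (δ₁ + δ₂ + ((m : ℝ) * α + 1) / 2) β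
          * mderiv β (fun x => g x * h x) x‖ₑ ^ 2
        ≤ C * (∫⁻ x in fatShell m r, ENNReal.ofReal (sobolevDensity s α δ₁ g x))
          * ∫⁻ x in fatShell m r, ENNReal.ofReal (sobolevDensity s α δ₂ h x) := by
  obtain ⟨C, hC, hCb⟩ := exists_scaled_sobolev_algebra (m := m) hs
  obtain ⟨B, hB⟩ := exists_iteratedDeriv_shellBump_bound s
  set δ : ℝ := δ₁ + δ₂ + ((m : ℝ) * α + 1) / 2 with hδ
  set K : ℝ → ℝ≥0∞ := fun δ => (m + 2) * ENNReal.ofReal ((2 ^ s * B * 6 ^ (s + |δ|)) ^ 2) with hK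
  set L : ℝ≥0∞ := ENNReal.ofReal ((6 ^ (s + |δ|)) ^ 2) with hL
  have hKtop : ∀ δ, K δ ≠ ⊤ := fun δ => by
    rw [hK]
    have h2 : ((m : ℝ≥0∞) + 2) ≠ ⊤ := by finiteness
    finiteness
  refine ⟨L * C * K δ₁ * K δ₂, ?_, fun r hr g h hg hgΩ hh hhΩ β hβ => ?_⟩
  · have h1 := hKtop δ₁
    have h2 := hKtop δ₂
    finiteness
  set U := shellCut r g
  set V := shellCut r h
  have hghΩ : tsupport (fun x => g x * h x) ⊆ degSector m α := (tsupport_mul_subset_left).trans hgΩ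
  have hpt : ∀ x ∈ shell m r,
      ‖jap x ^ aweight m α δ β * mderiv β (fun x => g x * h x) x‖ₑ ^ 2
        ≤ L * ‖r ^ δ‖ₑ ^ 2 * ‖(∏ i, anisoScale m α r i ^ β i)
          * mderiv β (fun x => U x * V x) x‖ₑ ^ 2 := by
    intro x hx
    by_cases hxΩ : x ∈ degSector m α
    · have heq : mderiv β (fun x => U x * V x) x = mderiv β (fun x => g x * h x) x :=
        (mderiv_congr_of_eventuallyEq
          ((shellCut_eventuallyEq hr g hx).mul (shellCut_eventuallyEq hr h hx)) β).eq_of_nhds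
      rw [heq, mul_assoc, ← mul_pow, ← enorm_mul, enorm_sq_eq_ofReal, enorm_sq_eq_ofReal, hL,
        ← ENNReal.ofReal_mul (by positivity), ← mul_pow]
      refine ENNReal.ofReal_le_ofReal ?_
      have hw := (weight_comparable hα0 hα1 δ hr (shell_subset_fatShell hr hx) hxΩ hβ).2
      have hj := jap_pos x
      rw [prod_anisoScale_pow α hr, ← mul_assoc (r ^ δ), ← Real.rpow_add hr, add_comm δ,
        ← aweight_add, ← mul_assoc, mul_pow, mul_pow _ (mderiv β _ x)]
      gcongr
    · rw [mderiv_eq_zero_of_notMem hghΩ hxΩ]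
      simp
  have hscale : ‖r ^ δ‖ₑ ^ 2 * ENNReal.ofReal (∏ i, anisoScale m α r i)⁻¹
      = ‖r ^ δ₁‖ₑ ^ 2 * ‖r ^ δ₂‖ₑ ^ 2 := by
    rw [prod_anisoScale α hr, enorm_sq_eq_ofReal, enorm_sq_eq_ofReal, enorm_sq_eq_ofReal,
      ← ENNReal.ofReal_mul (by positivity), ← ENNReal.ofReal_mul (by positivity),
      ← Real.rpow_neg hr.le, ← Real.rpow_mul_natCast hr.le, ← Real.rpow_mul_natCast hr.le,
      ← Real.rpow_mul_natCast hr.le, ← Real.rpow_add hr, ← Real.rpow_add hr, hδ]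
    congr 2
    push_cast
    ring
  calc _ ≤ ∫⁻ x in shell m r, L * ‖r ^ δ‖ₑ ^ 2 * ‖(∏ i, anisoScale m α r i ^ β i)
          * mderiv β (fun x => U x * V x) x‖ₑ ^ 2 :=
        setLIntegral_mono' (measurableSet_shell r) hpt
    _ ≤ ∫⁻ x, L * ‖r ^ δ‖ₑ ^ 2 * ‖(∏ i, anisoScale m α r i ^ β i)
          * mderiv β (fun x => U x * V x) x‖ₑ ^ 2 := setLIntegral_le_lintegral _ _
    _ = L * ‖r ^ δ‖ₑ ^ 2 * ∫⁻ x, ‖(∏ i, anisoScale m α r i ^ β i)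
          * mderiv β (fun x => U x * V x) x‖ₑ ^ 2 := lintegral_const_mul' _ _ (by finiteness)
    _ ≤ L * ‖r ^ δ‖ₑ ^ 2 * (C * ENNReal.ofReal (∏ i, anisoScale m α r i)⁻¹
          * scaledEnergy s (anisoScale m α r) U * scaledEnergy s (anisoScale m α r) V) := by
        gcongr
        exact hCb _ (anisoScale_pos α hr) U V (hg.shellCut r) (hh.shellCut r) β hβ
    _ = L * C * (‖r ^ δ₁‖ₑ ^ 2 * scaledEnergy s (anisoScale m α r) U)
          * (‖r ^ δ₂‖ₑ ^ 2 * scaledEnergy s (anisoScale m α r) V) := by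
        have h := congrArg (fun t => L * C * scaledEnergy s (anisoScale m α r) U
          * scaledEnergy s (anisoScale m α r) V * t) hscale
        calc _ = _ := by ring
          _ = _ := h
          _ = _ := by ring
    _ ≤ L * C * (K δ₁ * ∫⁻ x in fatShell m r, ENNReal.ofReal (sobolevDensity s α δ₁ g x))
          * (K δ₂ * ∫⁻ x in fatShell m r, ENNReal.ofReal (sobolevDensity s α δ₂ h x)) := by
        exact mul_le_mul' (mul_le_mul_right (scaledEnergy_shellCut_le hα0 hα1 δ₁ hB hr hg hgΩ) _)
          (scaledEnergy_shellCut_le hα0 hα1 δ₂ hB hr hh hhΩ)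
    _ = _ := by ring

lemma tsum_setLIntegral_fatShell_le (f : EuclideanSpace ℝ (Fin (m + 1)) → ℝ≥0∞) :
    ∑' j : ℕ, ∫⁻ x in fatShell m (2 ^ j), f x ≤ 4 * ∫⁻ x, f x := by
  have hdisj : Pairwise (Function.onFun Disjoint fun j : ℕ => shell m (2 ^ j / 4)) := by
    refine (Std.Symm.pairwise_on _).2 fun i j hij => ?_
    refine Set.disjoint_left.2 fun x hi hj => ?_
    have h : (2 : ℝ) ^ (i + 1) ≤ 2 ^ j := pow_le_pow_right₀ (by norm_num) hij
    rw [pow_succ] at h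
    linarith [hi.2, hj.1]
  have hshift : ∀ k : ℕ, ∑' j : ℕ, ∫⁻ x in shell m (2 ^ (j + k) / 4), f x ≤ ∫⁻ x, f x := by
    intro k
    rw [← lintegral_iUnion (s := fun j => shell m (2 ^ (j + k) / 4))
      (fun j => measurableSet_shell _) (fun i j hij => hdisj (by simpa using hij))]
    exact setLIntegral_le_lintegral _ _
  have hcover : ∀ j : ℕ, ∫⁻ x in fatShell m (2 ^ j), f x
      ≤ ∑ k : Fin 4, ∫⁻ x in shell m (2 ^ (j + (k : ℕ)) / 4), f x := by
    intro j
    rw [← tsum_fintype (L := .unconditional _)]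
    refine (lintegral_mono_set fun x hx => ?_).trans (lintegral_iUnion_le _ _)
    obtain ⟨h1, h2⟩ := hx
    have hj : (0 : ℝ) < 2 ^ j := by positivity
    simp only [Set.mem_iUnion, Fin.exists_fin_succ, shell, Set.mem_ofPred_eq, pow_add]
    norm_num
    by_cases c1 : x (Fin.last m) < 2 ^ j / 2
    · left; constructor <;> linarith
    by_cases c2 : x (Fin.last m) < 2 ^ j
    · right; left; constructor <;> linarith
    by_cases c3 : x (Fin.last m) < 2 ^ j * 2
    · right; right; left; constructor <;> linarith
    · right; right; right; constructor <;> linarith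
  calc _ ≤ ∑' j : ℕ, ∑ k : Fin 4, ∫⁻ x in shell m (2 ^ (j + (k : ℕ)) / 4), f x :=
        ENNReal.tsum_le_tsum hcover
    _ = ∑ k : Fin 4, ∑' j : ℕ, ∫⁻ x in shell m (2 ^ (j + (k : ℕ)) / 4), f x :=
        Summable.tsum_finsetSum fun _ _ => ENNReal.summable
    _ ≤ ∑ _k : Fin 4, ∫⁻ x, f x := Finset.sum_le_sum fun k _ => hshift k
    _ = _ := by simp

/-- The bilinear estimate for a single derivative of the product. -/
lemma exists_mderiv_estimate {s : ℕ} (hs : ((m : ℝ) + 1) / 2 < s) {α : ℝ} (hα0 : 0 < α)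
    (hα1 : α ≤ 1) (δ₁ δ₂ : ℝ) :
    ∃ C : ℝ≥0∞, C ≠ ⊤ ∧ ∀ g h : EuclideanSpace ℝ (Fin (m + 1)) → ℝ,
      IsTest g → tsupport g ⊆ degSector m α → IsTest h → tsupport h ⊆ degSector m α →
      ∀ β : Fin (m + 1) → ℕ, ∑ i, β i ≤ s →
      ∫⁻ x, ‖jap x ^ aweight m α (δ₁ + δ₂ + ((m : ℝ) * α + 1) / 2) β
          * mderiv β (fun x => g x * h x) x‖ₑ ^ 2
        ≤ C * ENNReal.ofReal (anisoNorm m s α δ₁ g ^ 2)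
          * ENNReal.ofReal (anisoNorm m s α δ₂ h ^ 2) := by
  obtain ⟨C, hC, hCb⟩ := exists_shell_estimate (m := m) hs hα0 hα1 δ₁ δ₂
  refine ⟨C * 4, by finiteness, fun g h hg hgΩ hh hhΩ β hβ => ?_⟩
  rw [← hg.lintegral_sobolevDensity, ← hh.lintegral_sobolevDensity]
  set F : EuclideanSpace ℝ (Fin (m + 1)) → ℝ≥0∞ := fun x =>
    ‖jap x ^ aweight m α (δ₁ + δ₂ + ((m : ℝ) * α + 1) / 2) β
      * mderiv β (fun x => g x * h x) x‖ₑ ^ 2 with hF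
  have hsupp : Function.support F ⊆ ⋃ j : ℕ, shell m (2 ^ j) := by
    intro x hx
    have hxΩ : x ∈ degSector m α := by
      by_contra hn
      refine hx ?_
      simp [hF, mderiv_eq_zero_of_notMem ((tsupport_mul_subset_left).trans hgΩ) hn β]
    obtain ⟨j, h1, h2⟩ := exists_nat_pow_near hxΩ.2 (one_lt_two (α := ℝ))
    exact Set.mem_iUnion.2 ⟨j, h1, by rwa [pow_succ, mul_comm] at h2⟩
  calc ∫⁻ x, F x = ∫⁻ x in ⋃ j : ℕ, shell m (2 ^ j), F x :=
        (setLIntegral_eq_of_support_subset hsupp).symm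
    _ ≤ ∑' j : ℕ, ∫⁻ x in shell m (2 ^ j), F x := lintegral_iUnion_le _ _
    _ ≤ ∑' j : ℕ, C * (∫⁻ x, ENNReal.ofReal (sobolevDensity s α δ₁ g x))
          * ∫⁻ x in fatShell m (2 ^ j), ENNReal.ofReal (sobolevDensity s α δ₂ h x) := by
        refine ENNReal.tsum_le_tsum fun j =>
          (hCb (2 ^ j) (by positivity) g h hg hgΩ hh hhΩ β hβ).trans ?_
        gcongr
        exact Measure.restrict_le_self
    _ ≤ C * (∫⁻ x, ENNReal.ofReal (sobolevDensity s α δ₁ g x))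
          * (4 * ∫⁻ x, ENNReal.ofReal (sobolevDensity s α δ₂ h x)) := by
        rw [ENNReal.tsum_mul_left]
        gcongr
        exact tsum_setLIntegral_fatShell_le _
    _ = _ := by ring

lemma anisoNorm_nonneg (s : ℕ) (α δ : ℝ) (u : EuclideanSpace ℝ (Fin (m + 1)) → ℝ) :
    0 ≤ anisoNorm m s α δ u :=
  Real.sqrt_nonneg _

/-- Anisotropic bilinear estimate: for `s > d/2` (with `d = m+1`),
`‖gh‖_{H^{s,δ₁+δ₂+((d−1)α+1)/2}_α} ≲ ‖g‖_{H^{s,δ₁}_α} ‖h‖_{H^{s,δ₂}_α}` for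
`g, h ∈ C_c^∞` supported in the degenerate sector. -/
theorem aniso_bilinear_estimate
    (m s : ℕ) (hs : ((m : ℝ) + 1) / 2 < s) (α δ₁ δ₂ : ℝ) (hα0 : 0 < α) (hα1 : α ≤ 1) :
    ∃ C > 0, ∀ g h : EuclideanSpace ℝ (Fin (m + 1)) → ℝ,
      ContDiff ℝ (⊤ : ℕ∞) g → HasCompactSupport g → tsupport g ⊆ degSector m α →
      ContDiff ℝ (⊤ : ℕ∞) h → HasCompactSupport h → tsupport h ⊆ degSector m α →
        anisoNorm m s α (δ₁ + δ₂ + ((m : ℝ) * α + 1) / 2) (fun x => g x * h x)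
          ≤ C * anisoNorm m s α δ₁ g * anisoNorm m s α δ₂ h := by
  obtain ⟨C, hC, hCb⟩ := exists_mderiv_estimate (m := m) hs hα0 hα1 δ₁ δ₂
  set N : ℝ := ((Fintype.card (Fin (m + 1) → Fin (s + 1)) : ℕ) : ℝ)
  refine ⟨√(N * C.toReal) + 1, by positivity, fun g h hg hgc hgΩ hh hhc hhΩ => ?_⟩
  have hgT : IsTest g := ⟨hg, hgc⟩
  have hhT : IsTest h := ⟨hh, hhc⟩
  have ha := anisoNorm_nonneg s α δ₁ g
  have hb := anisoNorm_nonneg s α δ₂ h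
  set a := anisoNorm m s α δ₁ g
  set b := anisoNorm m s α δ₂ h
  have hterm : ∀ β : Fin (m + 1) → ℕ, ∑ i, β i ≤ s →
      ∫ x, (jap x ^ aweight m α (δ₁ + δ₂ + ((m : ℝ) * α + 1) / 2) β
        * mderiv β (fun x => g x * h x) x) ^ 2 ≤ C.toReal * a ^ 2 * b ^ 2 := by
    intro β hβ
    have h1 := hCb g h hgT hgΩ hhT hhΩ β hβ
    simp only [enorm_sq_eq_ofReal] at h1
    rw [← ofReal_integral_eq_lintegral_ofReal ((hgT.mul hhT).integrable_weighted_sq _ _)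
      (.of_forall fun x => sq_nonneg _), ← ENNReal.ofReal_toReal hC,
      ← ENNReal.ofReal_mul (by positivity), ← ENNReal.ofReal_mul (by positivity)] at h1
    exact (ENNReal.ofReal_le_ofReal_iff (by positivity)).1 h1
  have hsum : anisoNorm m s α (δ₁ + δ₂ + ((m : ℝ) * α + 1) / 2) (fun x => g x * h x)
      ≤ √(N * C.toReal * (a * b) ^ 2) := by
    refine Real.sqrt_le_sqrt ?_
    calc _ ≤ ∑ _β : Fin (m + 1) → Fin (s + 1), C.toReal * a ^ 2 * b ^ 2 := by
          refine Finset.sum_le_sum fun β _ => ?_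
          split_ifs with hβ
          · exact hterm _ hβ
          · positivity
      _ = _ := by
          rw [Finset.sum_const, Finset.card_univ, nsmul_eq_mul]
          ring
  refine hsum.trans ?_
  rw [Real.sqrt_mul (by positivity), Real.sqrt_sq (by positivity), mul_assoc]
  gcongr
  linarith

end
end
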